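/- arXiv:0905.1942 — 2 statements merged into one kernel-verified Lean document; each statement's English description precedes it below -/
import Mathlib

section
/- Let 𝒫 be a hereditary property of graphs with colouring number χ_c(𝒫) = r ≥ 1. Then there exists ε = ε(𝒫) > 0 such that 2^{(1−1/r)n²/2} ≤ |𝒫_n| ≤ 2^{(1−1/r)n²/2 + n^{2−ε}} for every sufficiently large n ∈ ℕ. -/
open scoped symmDiff

namespace ABBM

variable {V : Type*}

/-- `A` shatters `B` in `G`: every subset of `B` is the neighbourhood (within `B`)
of some vertex of `A`.  This is the paper's relation `A → B`. -/
def Shatters (G : SimpleGraph V) (A B : Finset V) : Prop :=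
  ∀ S ⊆ B, ∃ a ∈ A, ∀ b ∈ B, G.Adj a b ↔ b ∈ S

/-- `G` is `U(k)`-free: there are no disjoint vertex sets `X`, `Y` such that the
bipartite graph induced by `G` between `X` and `Y` is (a copy of) `U(k)`;
equivalently, no disjoint `X`, `Y` with `|Y| = k` and `X` shattering `Y`. -/
def UFree (G : SimpleGraph V) (k : ℕ) : Prop :=
  ¬ ∃ X Y : Finset V, Disjoint X Y ∧ Y.card = k ∧ Shatters G X Y

/-- The induced subgraph of `G` on `S` is `U(k)`-free. -/
def UFreeOn (G : SimpleGraph V) (S : Finset V) (k : ℕ) : Prop :=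
  ¬ ∃ X Y : Finset V, X ⊆ S ∧ Y ⊆ S ∧ Disjoint X Y ∧ Y.card = k ∧ Shatters G X Y

open scoped Classical in
/-- The (full) neighbourhood `Γ(u)` of a vertex, as a `Finset`. -/
noncomputable def nbr [Fintype V] (G : SimpleGraph V) (u : V) : Finset V :=
  Finset.univ.filter fun v => G.Adj u v

/-- A hereditary property of labelled graphs: a collection of graphs on `[n]` for each `n`,
closed under relabelling (isomorphism) and under taking induced subgraphs; both closures are
expressed by closure under pulling back along arbitrary injections. -/
def IsHereditary (P : ∀ n, Set (SimpleGraph (Fin n))) : Prop :=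
  ∀ {m n : ℕ} (f : Fin m ↪ Fin n) (G : SimpleGraph (Fin n)),
    G ∈ P n → SimpleGraph.comap (f : Fin m → Fin n) G ∈ P m

/-- `G` belongs to the class `ℋ(r,v)`: its vertex set can be partitioned into `r` parts
so that part `j` induces a complete graph if `v j = true` and an empty graph otherwise. -/
def InHClass {n : ℕ} (r : ℕ) (v : Fin r → Bool) (G : SimpleGraph (Fin n)) : Prop :=
  ∃ f : Fin n → Fin r, ∀ x y : Fin n, x ≠ y → f x = f y → (G.Adj x y ↔ v (f x) = true)

/-- `ℋ(r,v) ⊆ 𝒫` for some `v ∈ {0,1}^r`. -/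
def HContained (P : ∀ n, Set (SimpleGraph (Fin n))) (r : ℕ) : Prop :=
  ∃ v : Fin r → Bool, ∀ (n : ℕ) (G : SimpleGraph (Fin n)), InHClass r v G → G ∈ P n

/-- The colouring number of `𝒫` equals `r`: `r` is maximal with `ℋ(r,v) ⊆ 𝒫` for some `v`. -/
def ColNumEq (P : ∀ n, Set (SimpleGraph (Fin n))) (r : ℕ) : Prop :=
  HContained P r ∧ ∀ s : ℕ, HContained P s → s ≤ r

section CellAverage

variable {Ω β γ : Type*} [Fintype Ω]

open scoped Classical in
/-- The cell of `ω` in the partition of `Ω` into the fibres of `f`. -/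
noncomputable def cell (f : Ω → β) (ω : Ω) : Finset Ω :=
  Finset.univ.filter fun ω' => f ω' = f ω

/-- The conditional expectation, for the uniform measure on `Ω`, of `X` given `f`. -/
noncomputable def cellAverage (f : Ω → β) (X : Ω → ℝ) (ω : Ω) : ℝ :=
  (∑ ω' ∈ cell f ω, X ω') / (cell f ω).card

lemma mem_cell {f : Ω → β} {ω ω' : Ω} : ω' ∈ cell f ω ↔ f ω' = f ω := by
  simp [cell]

lemma cell_congr {f : Ω → β} {ω ω' : Ω} (h : f ω = f ω') : cell f ω = cell f ω' := by
  unfold cell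
  rw [h]

lemma card_cell_pos (f : Ω → β) (ω : Ω) : (0 : ℝ) < (cell f ω).card := by
  exact_mod_cast Finset.card_pos.2 ⟨ω, mem_cell.2 rfl⟩

lemma cellAverage_factorsThrough (f : Ω → β) (X : Ω → ℝ) :
    (cellAverage f X).FactorsThrough f := by
  intro ω ω' h
  rw [cellAverage, cellAverage, cell_congr h]

lemma cellAverage_mul {f : Ω → β} {Y : Ω → ℝ} (hY : Y.FactorsThrough f) (X : Ω → ℝ) (ω : Ω) :
    cellAverage f (fun ω => Y ω * X ω) ω = Y ω * cellAverage f X ω := by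
  rw [cellAverage, cellAverage, ← mul_div_assoc, Finset.mul_sum]
  congr 1
  exact Finset.sum_congr rfl fun ω' h => by rw [hY (mem_cell.1 h)]

lemma cellAverage_mono (f : Ω → β) {X Y : Ω → ℝ} (h : ∀ ω, X ω ≤ Y ω) (ω : Ω) :
    cellAverage f X ω ≤ cellAverage f Y ω := by
  unfold cellAverage
  gcongr
  exact h _

lemma cellAverage_const (f : Ω → β) (c : ℝ) (ω : Ω) : cellAverage f (fun _ => c) ω = c := by
  have := card_cell_pos f ω
  simp only [cellAverage, Finset.sum_const, nsmul_eq_mul]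
  field_simp

lemma cellAverage_sub (f : Ω → β) (X Y : Ω → ℝ) (ω : Ω) :
    cellAverage f (fun ω => X ω - Y ω) ω = cellAverage f X ω - cellAverage f Y ω := by
  simp only [cellAverage, Finset.sum_sub_distrib, sub_div]

lemma abs_cellAverage_le (f : Ω → β) (X : Ω → ℝ) (ω : Ω) :
    |cellAverage f X ω| ≤ cellAverage f (fun ω => |X ω|) ω := by
  unfold cellAverage
  rw [abs_div, Nat.abs_cast]
  gcongr
  exact Finset.abs_sum_le_sum_abs _ _

lemma sum_cellAverage (f : Ω → β) (X : Ω → ℝ) : ∑ ω, cellAverage f X ω = ∑ ω, X ω := by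
  classical
  have h : ∀ ω, cellAverage f X ω
      = ∑ ω', if f ω' = f ω then X ω' / (cell f ω').card else 0 := by
    intro ω
    rw [cellAverage, Finset.sum_div, ← Finset.sum_filter]
    refine Finset.sum_congr (by ext; simp [mem_cell]) fun ω' h => ?_
    rw [cell_congr (mem_cell.1 h)]
  simp_rw [h]
  rw [Finset.sum_comm]
  refine Finset.sum_congr rfl fun ω' _ => ?_
  have h2 := card_cell_pos f ω'
  rw [← Finset.sum_filter, Finset.sum_const, nsmul_eq_mul]
  have h3 : (Finset.univ.filter fun ω => f ω' = f ω) = cell f ω' := by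
    ext; simp [mem_cell, eq_comm]
  rw [h3]
  field_simp

lemma cellAverage_cellAverage {f : Ω → β} {g : Ω → γ} (hfg : f.FactorsThrough g) (X : Ω → ℝ)
    (ω : Ω) : cellAverage f (cellAverage g X) ω = cellAverage f X ω := by
  classical
  have key : ∀ Z : Ω → ℝ, ∑ ω' ∈ cell f ω, Z ω'
      = ∑ ω', (if f ω' = f ω then (1 : ℝ) else 0) * Z ω' := by
    intro Z
    simp [cell, Finset.sum_filter]
  have hm : (fun ω' => if f ω' = f ω then (1 : ℝ) else 0).FactorsThrough g := by
    intro a b hab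
    simp [hfg hab]
  unfold cellAverage
  rw [key X, ← sum_cellAverage g]
  congr 1
  rw [show (∑ ω' ∈ cell f ω, (∑ ω'' ∈ cell g ω', X ω'') / ((cell g ω').card : ℝ))
    = ∑ ω' ∈ cell f ω, cellAverage g X ω' from rfl, key]
  exact Finset.sum_congr rfl fun ω' _ => (cellAverage_mul hm X ω').symm

lemma sum_sq_cellAverage_sub {f : Ω → β} {g : Ω → γ} (hfg : f.FactorsThrough g) (X : Ω → ℝ) :
    ∑ ω, (cellAverage g X ω - cellAverage f X ω) ^ 2
      = ∑ ω, cellAverage g X ω ^ 2 - ∑ ω, cellAverage f X ω ^ 2 := by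
  have h : ∑ ω, cellAverage f X ω * cellAverage g X ω = ∑ ω, cellAverage f X ω ^ 2 := by
    rw [← sum_cellAverage f]
    refine Finset.sum_congr rfl fun ω _ => ?_
    rw [cellAverage_mul (cellAverage_factorsThrough f X), cellAverage_cellAverage hfg, sq]
  have h2 : ∀ ω, (cellAverage g X ω - cellAverage f X ω) ^ 2
      = cellAverage g X ω ^ 2 - 2 * (cellAverage f X ω * cellAverage g X ω)
        + cellAverage f X ω ^ 2 := fun ω => by ring
  simp_rw [h2]
  rw [Finset.sum_add_distrib, Finset.sum_sub_distrib, ← Finset.mul_sum, h]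
  ring

/-- If each `X e` is predicted about as well by the finer information `g e`, which determines all
the other `X e'`, as by `f`, then the `X e` are nearly independent conditionally on `f`. -/
lemma abs_cellAverage_prod_sub_le {ι : Type*} (s : Finset ι) (f : Ω → β) (g : ι → Ω → γ)
    (X : ι → Ω → ℝ) (hfg : ∀ e ∈ s, f.FactorsThrough (g e)) (h0 : ∀ e ∈ s, ∀ ω, 0 ≤ X e ω)
    (h1 : ∀ e ∈ s, ∀ ω, X e ω ≤ 1)
    (hX : ∀ e ∈ s, ∀ e' ∈ s, e' ≠ e → (X e').FactorsThrough (g e)) (ω : Ω) :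
    |cellAverage f (fun ω => ∏ e ∈ s, X e ω) ω - ∏ e ∈ s, cellAverage f (X e) ω|
      ≤ ∑ e ∈ s, cellAverage f
          (fun ω => |cellAverage (g e) (X e) ω - cellAverage f (X e) ω|) ω := by
  classical
  induction s using Finset.induction_on with
  | empty => simp [cellAverage_const]
  | insert a s ha ih =>
    have ih := ih (fun e he => hfg e (Finset.mem_insert_of_mem he))
      (fun e he => h0 e (Finset.mem_insert_of_mem he))
      (fun e he => h1 e (Finset.mem_insert_of_mem he))
      (fun e he e' he' => hX e (Finset.mem_insert_of_mem he) e' (Finset.mem_insert_of_mem he'))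
    simp only [Finset.prod_insert ha, Finset.sum_insert ha]
    have hfa := hfg a (Finset.mem_insert_self _ _)
    set Y : Ω → ℝ := fun ω => ∏ e ∈ s, X e ω with hYdef
    have hY0 : ∀ ω, 0 ≤ Y ω := fun ω =>
      Finset.prod_nonneg fun e he => h0 e (Finset.mem_insert_of_mem he) ω
    have hY1 : ∀ ω, Y ω ≤ 1 := fun ω =>
      Finset.prod_le_one (fun e he => h0 e (Finset.mem_insert_of_mem he) ω)
        fun e he => h1 e (Finset.mem_insert_of_mem he) ω
    have hYm : Y.FactorsThrough (g a) := by
      intro u v huv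
      refine Finset.prod_congr rfl fun e he => ?_
      exact hX a (Finset.mem_insert_self _ _) e (Finset.mem_insert_of_mem he)
        (fun h => ha (h ▸ he)) huv
    have e1 : cellAverage f (fun ω => X a ω * Y ω) ω
        = cellAverage f (fun ω => Y ω * cellAverage (g a) (X a) ω) ω := by
      rw [← cellAverage_cellAverage hfa]
      congr 1
      funext u
      rw [← cellAverage_mul hYm]
      congr 1
      funext u
      ring
    have e2 : cellAverage f (X a) ω * cellAverage f Y ω
        = cellAverage f (fun ω => Y ω * cellAverage f (X a) ω) ω := by
      rw [← cellAverage_mul (cellAverage_factorsThrough f (X a))]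
      congr 1
      funext u
      ring
    have e3 : |cellAverage f (fun ω => X a ω * Y ω) ω - cellAverage f (X a) ω * cellAverage f Y ω|
        ≤ cellAverage f
          (fun ω => |cellAverage (g a) (X a) ω - cellAverage f (X a) ω|) ω := by
      rw [e1, e2, ← cellAverage_sub]
      refine (abs_cellAverage_le _ _ _).trans (cellAverage_mono _ (fun u => ?_) _)
      rw [← mul_sub, abs_mul, abs_of_nonneg (hY0 u)]
      exact mul_le_of_le_one_left (abs_nonneg _) (hY1 u)
    have p0 : 0 ≤ cellAverage f (X a) ω := by
      rw [← cellAverage_const f 0 ω]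
      exact cellAverage_mono _ (h0 a (Finset.mem_insert_self _ _)) _
    have p1 : cellAverage f (X a) ω ≤ 1 := by
      rw [← cellAverage_const f 1 ω]
      exact cellAverage_mono _ (h1 a (Finset.mem_insert_self _ _)) _
    have e4 : |cellAverage f (X a) ω * (cellAverage f Y ω - ∏ e ∈ s, cellAverage f (X e) ω)|
        ≤ ∑ e ∈ s, cellAverage f
          (fun ω => |cellAverage (g e) (X e) ω - cellAverage f (X e) ω|) ω := by
      rw [abs_mul, abs_of_nonneg p0]
      exact (mul_le_of_le_one_left (abs_nonneg _) p1).trans ih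
    calc _ = |(cellAverage f (fun ω => X a ω * Y ω) ω - cellAverage f (X a) ω * cellAverage f Y ω)
          + cellAverage f (X a) ω * (cellAverage f Y ω - ∏ e ∈ s, cellAverage f (X e) ω)| := by
            congr 1; ring
      _ ≤ _ := (abs_add_le _ _).trans (add_le_add e3 e4)

end CellAverage

section Obstruction

lemma exists_ramsey_number (a b : ℕ) : ∃ M : ℕ, ∀ {W : Type} (S : Finset W) (c : W → W → Bool),
    (∀ x y, c x y = c y x) → M ≤ S.card →
      (∃ T ⊆ S, T.card = a ∧ ∀ x ∈ T, ∀ y ∈ T, x ≠ y → c x y = true) ∨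
      (∃ T ⊆ S, T.card = b ∧ ∀ x ∈ T, ∀ y ∈ T, x ≠ y → c x y = false) := by
  classical
  induction a generalizing b with
  | zero => exact ⟨0, fun S c _ _ => Or.inl ⟨∅, by simp⟩⟩
  | succ a iha =>
    induction b with
    | zero => exact ⟨0, fun S c _ _ => Or.inr ⟨∅, by simp⟩⟩
    | succ b ihb =>
      obtain ⟨M₁, h₁⟩ := iha (b + 1)
      obtain ⟨M₂, h₂⟩ := ihb
      refine ⟨M₁ + M₂ + 1, fun {W} S c hc hS => ?_⟩
      obtain ⟨x, hx⟩ : S.Nonempty := Finset.card_pos.1 (by omega)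
      set A := (S.erase x).filter fun y => c x y = true with hA
      set B := (S.erase x).filter fun y => ¬ c x y = true with hB
      have hAB : A.card + B.card = S.card - 1 := by
        rw [hA, hB, Finset.card_filter_add_card_filter_not, Finset.card_erase_of_mem hx]
      have hAS : A ⊆ S := (Finset.filter_subset _ _).trans (Finset.erase_subset _ _)
      have hBS : B ⊆ S := (Finset.filter_subset _ _).trans (Finset.erase_subset _ _)
      have extend : ∀ (k : ℕ) (v : Bool) (T : Finset W), T ⊆ S → T.card = k →
          (∀ y ∈ T, y ≠ x ∧ c x y = v) → (∀ y ∈ T, ∀ z ∈ T, y ≠ z → c y z = v) →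
          ∃ T ⊆ S, T.card = k + 1 ∧ ∀ y ∈ T, ∀ z ∈ T, y ≠ z → c y z = v := by
        intro k v T hTS hT hxT hv
        refine ⟨insert x T, Finset.insert_subset hx hTS, ?_, ?_⟩
        · rw [Finset.card_insert_of_notMem fun h => (hxT x h).1 rfl, hT]
        · intro y hy z hz hyz
          rcases Finset.mem_insert.1 hy with rfl | hy' <;>
            rcases Finset.mem_insert.1 hz with rfl | hz'
          · exact absurd rfl hyz
          · exact (hxT z hz').2
          · rw [hc]; exact (hxT y hy').2
          · exact hv y hy' z hz' hyz
      rcases le_or_gt M₁ A.card with h | h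
      · rcases h₁ A c hc h with ⟨T, hTA, hT, hv⟩ | ⟨T, hTA, hT, hv⟩
        · left
          refine extend a true T (hTA.trans hAS) hT (fun y hy => ?_) hv
          have := hTA hy
          simp only [hA, Finset.mem_filter, Finset.mem_erase] at this
          exact ⟨this.1.1, this.2⟩
        · exact Or.inr ⟨T, hTA.trans hAS, hT, hv⟩
      · rcases h₂ B c hc (by omega) with ⟨T, hTB, hT, hv⟩ | ⟨T, hTB, hT, hv⟩
        · exact Or.inl ⟨T, hTB.trans hBS, hT, hv⟩
        · right
          refine extend b false T (hTB.trans hBS) hT (fun y hy => ?_) hv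
          have := hTB hy
          simp only [hB, Finset.mem_filter, Finset.mem_erase, Bool.not_eq_true] at this
          exact ⟨this.1.1, this.2⟩

/-- If `𝒫` contains no class `ℋ(s,v)`, then every 2-colouring of the pairs of a large `s`-partite
vertex set is compatible, inside the parts, with a graph outside `𝒫`. -/
lemma exists_obstruction {P : ∀ n, Set (SimpleGraph (Fin n))} {s : ℕ} (hs : ¬ HContained P s) :
    ∃ M : ℕ, 1 ≤ M ∧ ∀ col : Fin s × Fin M → Fin s × Fin M → Bool,
      (∀ x y, col x y = col y x) →
      ∃ (N : ℕ) (ψ : Fin N ↪ Fin s × Fin M) (F : SimpleGraph (Fin N)), F ∉ P N ∧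
        ∀ u u', u ≠ u' → (ψ u).1 = (ψ u').1 → (F.Adj u u' ↔ col (ψ u) (ψ u') = true) := by
  unfold HContained at hs
  push Not at hs
  choose N F hF hFP using hs
  choose f hf using hF
  obtain ⟨m, hm⟩ : ∃ m, ∀ v, N v ≤ m :=
    ⟨Finset.univ.sup N, fun v => Finset.le_sup (Finset.mem_univ v)⟩
  obtain ⟨M, hM⟩ := exists_ramsey_number m m
  refine ⟨M + 1, by omega, fun col hcol => ?_⟩
  have hpart : ∀ a : Fin s, ∃ v : Bool, ∃ ι : Fin m ↪ Fin (M + 1),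
      ∀ i j, i ≠ j → col (a, ι i) (a, ι j) = v := by
    intro a
    obtain ⟨v, T, hT, hv⟩ : ∃ v : Bool, ∃ T : Finset (Fin (M + 1)), T.card = m ∧
        ∀ x ∈ T, ∀ y ∈ T, x ≠ y → col (a, x) (a, y) = v := by
      rcases hM Finset.univ (fun x y => col (a, x) (a, y)) (fun x y => hcol _ _) (by simp) with
        ⟨T, -, h⟩ | ⟨T, -, h⟩
      · exact ⟨true, T, h⟩
      · exact ⟨false, T, h⟩
    refine ⟨v, (T.orderEmbOfFin hT).toEmbedding, fun i j hij => hv _ ?_ _ ?_ ?_⟩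
    · exact T.orderEmbOfFin_mem hT i
    · exact T.orderEmbOfFin_mem hT j
    · exact fun h => hij ((T.orderEmbOfFin hT).injective h)
  choose v ι hι using hpart
  refine ⟨N v, ⟨fun u => (f v u, ι (f v u) (Fin.castLE (hm v) u)), ?_⟩, F v, hFP v, ?_⟩
  · intro u u' h
    simp only [Prod.mk.injEq] at h
    obtain ⟨h1, h2⟩ := h
    rw [h1] at h2
    exact Fin.castLE_injective _ ((ι _).injective h2)
  · intro u u' huu' h
    change f v u = f v u' at h
    change _ ↔ col (f v u, ι (f v u) (Fin.castLE (hm v) u))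
      (f v u', ι (f v u') (Fin.castLE (hm v) u')) = true
    rw [hf v u u' huu' h, h, hι (f v u')]
    exact fun h => huu' (Fin.castLE_injective _ h)

end Obstruction

section Supersaturation

variable {V : Type*} [Fintype V]

open scoped Classical in
/-- The ordered `j`-cliques of `D`. -/
noncomputable def cliqueTuples (D : SimpleGraph V) (j : ℕ) : Finset (Fin j → V) :=
  Finset.univ.filter fun x => ∀ a b, a ≠ b → D.Adj (x a) (x b)

open scoped Classical in
/-- The common neighbours of the entries of a tuple. -/
noncomputable def commonNbr (D : SimpleGraph V) {j : ℕ} (x : Fin j → V) : Finset V :=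
  Finset.univ.filter fun y => ∀ a, D.Adj y (x a)

lemma insertNth_mem_cliqueTuples (D : SimpleGraph V) {j : ℕ} (i : Fin (j + 1)) (y : V)
    (c : Fin j → V) : Fin.insertNth (α := fun _ => V) i y c ∈ cliqueTuples D (j + 1) ↔
      c ∈ cliqueTuples D j ∧ y ∈ commonNbr D c := by
  simp only [cliqueTuples, commonNbr, Finset.mem_filter, Finset.mem_univ, true_and]
  constructor
  · refine fun h => ⟨fun a b hab => ?_, fun a => ?_⟩
    · simpa using h (i.succAbove a) (i.succAbove b) (by simpa using hab)
    · simpa using h i (i.succAbove a) (Fin.succAbove_ne i a).symm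
  · rintro ⟨h1, h2⟩ a b hab
    rcases Fin.eq_self_or_eq_succAbove i a with ha | ⟨a', ha⟩ <;>
      rcases Fin.eq_self_or_eq_succAbove i b with hb | ⟨b', hb⟩ <;> rw [ha, hb] at hab ⊢
    · exact absurd rfl hab
    · simpa using h2 b'
    · simpa using (h2 a').symm
    · simpa using h1 a' b' (by simpa using hab)

lemma sum_cliqueTuples_succ (D : SimpleGraph V) {j : ℕ} (i : Fin (j + 1))
    (g : (Fin j → V) → ℝ) :
    ∑ C ∈ cliqueTuples D (j + 1), g (C ∘ i.succAbove)
      = ∑ c ∈ cliqueTuples D j, ((commonNbr D c).card : ℝ) * g c := by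
  classical
  have h1 : ∑ C ∈ cliqueTuples D (j + 1), g (C ∘ i.succAbove)
      = ∑ C : Fin (j + 1) → V,
        if C ∈ cliqueTuples D (j + 1) then g (C ∘ i.succAbove) else 0 := by
    rw [← Finset.sum_filter]; simp
  rw [h1, ← (Fin.insertNthEquiv (fun _ => V) i).sum_comp, Fintype.sum_prod_type_right]
  have h2 : ∀ (c : Fin j → V) (y : V),
      (if Fin.insertNthEquiv (fun _ => V) i (y, c) ∈ cliqueTuples D (j + 1) then
        g (Fin.insertNthEquiv (fun _ => V) i (y, c) ∘ i.succAbove) else 0)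
      = if c ∈ cliqueTuples D j then (if y ∈ commonNbr D c then g c else 0) else 0 := by
    intro c y
    have e : (Fin.insertNthEquiv (fun _ => V) i (y, c) ∘ i.succAbove) = c := by
      funext a; simp [Fin.insertNthEquiv]
    rw [e, ← ite_and]
    exact if_congr (insertNth_mem_cliqueTuples D i y c) rfl rfl
  have h3 : ∀ c : Fin j → V, ∑ y, (if c ∈ cliqueTuples D j then
      (if y ∈ commonNbr D c then g c else 0) else 0)
      = if c ∈ cliqueTuples D j then ((commonNbr D c).card : ℝ) * g c else 0 := by
    intro c
    split_ifs <;> simp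
  rw [Finset.sum_congr rfl fun c _ => (Finset.sum_congr rfl fun y _ => h2 c y).trans (h3 c)]
  rw [← Finset.sum_filter]; simp

lemma card_cliqueTuples_succ (D : SimpleGraph V) (j : ℕ) :
    ((cliqueTuples D (j + 1)).card : ℝ)
      = ∑ c ∈ cliqueTuples D j, ((commonNbr D c).card : ℝ) := by
  have := sum_cliqueTuples_succ D (0 : Fin (j + 1)) fun _ => 1
  simpa using this

lemma sum_card_commonNbr_le (D : SimpleGraph V) {j : ℕ} (C : Fin (j + 1) → V) :
    ∑ i : Fin (j + 1), ((commonNbr D (C ∘ i.succAbove)).card : ℝ)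
      ≤ Fintype.card V + j * (commonNbr D C).card := by
  classical
  have h1 : ∀ y : V, ∑ i : Fin (j + 1), (if ∀ a, D.Adj y (C (i.succAbove a)) then (1 : ℝ) else 0)
      ≤ 1 + j * (if ∀ a, D.Adj y (C a) then (1 : ℝ) else 0) := by
    intro y
    split_ifs with h
    · refine (Finset.sum_le_sum (g := fun _ => (1 : ℝ)) fun i _ => ?_).trans ?_
      · split_ifs <;> norm_num
      · simp [add_comm]
    · push Not at h
      obtain ⟨a₀, ha₀⟩ := h
      refine (Finset.sum_le_sum (g := fun i => if i = a₀ then (1 : ℝ) else 0) fun i _ => ?_).trans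
        (by simp)
      by_cases hi : i = a₀
      · simp only [hi, if_true]
        split_ifs <;> norm_num
      · obtain ⟨b, hb⟩ := Fin.exists_succAbove_eq (Ne.symm hi)
        rw [if_neg, if_neg hi]
        exact fun h => ha₀ (hb ▸ h b)
  have h2 := Finset.sum_le_sum fun y (_ : y ∈ (Finset.univ : Finset V)) => h1 y
  rw [Finset.sum_comm, Finset.sum_add_distrib, ← Finset.mul_sum] at h2
  simpa [commonNbr] using h2

lemma moon_moser (D : SimpleGraph V) (j : ℕ) :
    (j + 1 : ℝ) * ((cliqueTuples D (j + 1)).card : ℝ) ^ 2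
      ≤ (cliqueTuples D j).card * (Fintype.card V * (cliqueTuples D (j + 1)).card
        + j * (cliqueTuples D (j + 2)).card) := by
  have h1 : (j + 1 : ℝ) * ∑ c ∈ cliqueTuples D j, ((commonNbr D c).card : ℝ) ^ 2
      ≤ Fintype.card V * (cliqueTuples D (j + 1)).card + j * (cliqueTuples D (j + 2)).card := by
    calc (j + 1 : ℝ) * ∑ c ∈ cliqueTuples D j, ((commonNbr D c).card : ℝ) ^ 2
        = ∑ i : Fin (j + 1), ∑ C ∈ cliqueTuples D (j + 1),
            ((commonNbr D (C ∘ i.succAbove)).card : ℝ) := by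
          have := fun i : Fin (j + 1) => sum_cliqueTuples_succ D i
            fun c => ((commonNbr D c).card : ℝ)
          simp_rw [this]
          simp [sq]
      _ = ∑ C ∈ cliqueTuples D (j + 1), ∑ i : Fin (j + 1),
            ((commonNbr D (C ∘ i.succAbove)).card : ℝ) := Finset.sum_comm
      _ ≤ ∑ C ∈ cliqueTuples D (j + 1),
            ((Fintype.card V : ℝ) + j * (commonNbr D C).card) :=
          Finset.sum_le_sum fun C _ => sum_card_commonNbr_le D C
      _ = _ := by
          rw [Finset.sum_add_distrib, ← Finset.mul_sum, ← card_cliqueTuples_succ]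
          simp [mul_comm]
  have h2 : ((cliqueTuples D (j + 1)).card : ℝ) ^ 2
      ≤ (cliqueTuples D j).card * ∑ c ∈ cliqueTuples D j, ((commonNbr D c).card : ℝ) ^ 2 := by
    rw [card_cliqueTuples_succ]
    exact sq_sum_le_card_mul_sum_sq
  calc _ ≤ (j + 1 : ℝ) * ((cliqueTuples D j).card *
        ∑ c ∈ cliqueTuples D j, ((commonNbr D c).card : ℝ) ^ 2) := by gcongr
    _ = (cliqueTuples D j).card * ((j + 1 : ℝ) *
        ∑ c ∈ cliqueTuples D j, ((commonNbr D c).card : ℝ) ^ 2) := by ring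
    _ ≤ _ := by gcongr

lemma pow_mul_le_card_cliqueTuples [Nonempty V] (D : SimpleGraph V) {r : ℕ} (hr : 1 ≤ r) {δ : ℝ}
    (hδ : 0 < δ) (hD : (1 - 1 / (r : ℝ) + δ) * (Fintype.card V : ℝ) ^ 2
      ≤ (cliqueTuples D 2).card) :
    δ ^ r * (Fintype.card V : ℝ) ^ (r + 1) ≤ (cliqueTuples D (r + 1)).card := by
  set n : ℝ := (Fintype.card V : ℝ) with hn
  have hn0 : 0 < n := by rw [hn]; exact_mod_cast Fintype.card_pos
  have hr0 : (0 : ℝ) < r := by exact_mod_cast hr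
  have h1 : ((cliqueTuples D 1).card : ℝ) = n := by
    have : cliqueTuples D 1 = Finset.univ := by
      ext x
      simp only [cliqueTuples, Finset.mem_filter, Finset.mem_univ, true_and, iff_true]
      intro a b hab
      exact absurd (Subsingleton.elim a b) hab
    rw [this]; simp [hn]
  have main : ∀ j : ℕ, j + 1 ≤ r → δ ^ j * n ^ (j + 1) ≤ (cliqueTuples D (j + 1)).card ∧
      (1 - (j + 1) / (r : ℝ) + δ) * (n * (cliqueTuples D (j + 1)).card)
        ≤ (cliqueTuples D (j + 2)).card := by
    intro j
    induction j with
    | zero =>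
      intro _
      refine ⟨by simp [h1], ?_⟩
      simp only [Nat.cast_zero, zero_add, h1]
      calc _ = (1 - 1 / (r : ℝ) + δ) * n ^ 2 := by ring
        _ ≤ _ := hD
    | succ j ih =>
      intro hj
      obtain ⟨ih1, ih2⟩ := ih (by omega)
      have hjr : (j + 1 : ℝ) / r ≤ 1 := by
        rw [div_le_one hr0]; exact_mod_cast (by omega : j + 1 ≤ r)
      set a : ℝ := ((cliqueTuples D (j + 1)).card : ℝ)
      set b : ℝ := ((cliqueTuples D (j + 1 + 1)).card : ℝ)
      set c : ℝ := ((cliqueTuples D (j + 1 + 2)).card : ℝ)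
      set ρ : ℝ := 1 - (j + 1) / (r : ℝ) + δ with hρ
      have hρδ : δ ≤ ρ := by rw [hρ]; linarith
      have ha : 0 < a := lt_of_lt_of_le (by positivity) ih1
      have hb : ρ * (n * a) ≤ b := ih2
      have hρ0 : 0 < ρ := hδ.trans_le hρδ
      have hb0 : 0 < b := lt_of_lt_of_le (by positivity) hb
      have hmm : ((j + 1 : ℕ) + 1 : ℝ) * b ^ 2 ≤ a * (n * b + (j + 1 : ℕ) * c) :=
        moon_moser D (j + 1)
      push_cast at hmm ⊢
      have hc0 : 0 ≤ c := Nat.cast_nonneg _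
      have hkey : ((j : ℝ) + 1 + 1) * ρ * n * b ≤ n * b + (j + 1) * c := by
        have e : ρ * n * (((j : ℝ) + 1 + 1) * b ^ 2) ≤ b * (n * b + (j + 1) * c) := by
          calc ρ * n * (((j : ℝ) + 1 + 1) * b ^ 2)
              ≤ ρ * n * (a * (n * b + (j + 1) * c)) := by gcongr
            _ = ρ * (n * a) * (n * b + (j + 1) * c) := by ring
            _ ≤ b * (n * b + (j + 1) * c) := by gcongr
        have e2 : b * (((j : ℝ) + 1 + 1) * ρ * n * b) ≤ b * (n * b + (j + 1) * c) := by
          calc _ = ρ * n * (((j : ℝ) + 1 + 1) * b ^ 2) := by ring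
            _ ≤ _ := e
        exact le_of_mul_le_mul_left e2 hb0
      constructor
      · calc δ ^ (j + 1) * n ^ (j + 1 + 1) = δ * (n * (δ ^ j * n ^ (j + 1))) := by ring
          _ ≤ ρ * (n * a) := by gcongr
          _ ≤ b := hb
      · have hj0 : (0 : ℝ) < j + 1 := by positivity
        have e3 : (j + 1 : ℝ) * (1 - (j + 1 + 1) / (r : ℝ) + δ)
            ≤ ((j : ℝ) + 1 + 1) * ρ - 1 := by
          rw [hρ]
          have : (j + 1 : ℝ) * (1 - (j + 1 + 1) / (r : ℝ) + δ) + δ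
            = ((j : ℝ) + 1 + 1) * (1 - (j + 1) / (r : ℝ) + δ) - 1 := by
              field_simp; ring
          linarith
        have e4 : (j + 1 : ℝ) * ((1 - (j + 1 + 1) / (r : ℝ) + δ) * (n * b)) ≤ (j + 1) * c := by
          calc _ = (j + 1 : ℝ) * (1 - (j + 1 + 1) / (r : ℝ) + δ) * (n * b) := by ring
            _ ≤ (((j : ℝ) + 1 + 1) * ρ - 1) * (n * b) := by gcongr
            _ ≤ _ := by linarith
        exact le_of_mul_le_mul_left e4 hj0
  obtain ⟨j, rfl⟩ : ∃ j, r = j + 1 := ⟨r - 1, by omega⟩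
  obtain ⟨m1, m2⟩ := main j le_rfl
  push_cast at m2
  rw [div_self (by positivity)] at m2
  calc δ ^ (j + 1) * n ^ (j + 1 + 1) = δ * (n * (δ ^ j * n ^ (j + 1))) := by ring
    _ ≤ δ * (n * (cliqueTuples D (j + 1)).card) := by gcongr
    _ ≤ _ := by linarith

lemma card_mul_mean_pow_le {β : Type*} [Fintype β] [Nonempty β] (g : β → ℝ) (hg : ∀ b, 0 ≤ g b)
    (M : ℕ) : (Fintype.card β : ℝ) * ((∑ b, g b) / Fintype.card β) ^ M ≤ ∑ b, g b ^ M := by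
  have h0 : (0 : ℝ) < Fintype.card β := by exact_mod_cast Fintype.card_pos
  cases M with
  | zero => simp
  | succ M =>
    refine le_trans (le_of_eq ?_)
      (pow_sum_div_card_le_sum_pow (s := Finset.univ) (fun b _ => hg b) M)
    rw [Finset.card_univ, div_pow]
    field_simp
    ring

open scoped Classical in
/-- The `M`-fold blow-ups of the `s`-tuples in `S`. -/
noncomputable def blowups {s : ℕ} (S : Finset (Fin s → V)) (M : ℕ) :
    Finset (Fin s → Fin M → V) :=
  Finset.univ.filter fun Φ => ∀ c : Fin s → Fin M, (fun a => Φ a (c a)) ∈ S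

lemma le_card_blowups [Nonempty V] {s : ℕ} (S : Finset (Fin s → V)) (M : ℕ) :
    (Fintype.card V : ℝ) ^ (s * M) * ((S.card : ℝ) / (Fintype.card V : ℝ) ^ s) ^ (M ^ s)
      ≤ (blowups S M).card := by
  classical
  set n : ℝ := (Fintype.card V : ℝ) with hn
  have hn0 : 0 < n := by rw [hn]; exact_mod_cast Fintype.card_pos
  induction s with
  | zero =>
    have : (S.card : ℝ) ≤ (blowups S M).card := by
      rcases S.eq_empty_or_nonempty with rfl | ⟨x, hx⟩
      · simp
      · have : S.card ≤ 1 := Finset.card_le_one_of_subsingleton S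
        have h2 : (fun a => Fin.elim0 a) ∈ blowups S M := by
          simp only [blowups, Finset.mem_filter, Finset.mem_univ, true_and]
          intro c
          convert hx
        exact_mod_cast this.trans (Finset.card_pos.2 ⟨_, h2⟩)
    simpa using this
  | succ s ih =>
    set S' : (Fin M → V) → Finset (Fin s → V) := fun Φ₀ =>
      Finset.univ.filter fun x => ∀ i, Fin.cons (α := fun _ => V) (Φ₀ i) x ∈ S with hS'
    have hle : ∑ Φ₀, ((blowups (S' Φ₀) M).card : ℝ) ≤ (blowups S M).card := by
      rw [← Nat.cast_sum, ← Finset.card_sigma]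
      norm_cast
      refine Finset.card_le_card_of_injOn
        (fun p => Fin.cons (α := fun _ => Fin M → V) p.1 p.2) ?_ ?_
      · rintro ⟨Φ₀, Φ⟩ h
        simp only [Finset.coe_sigma, Set.mem_sigma_iff, Finset.mem_coe, Finset.mem_univ, true_and,
          blowups, Finset.mem_filter, hS'] at h ⊢
        intro c
        convert h (fun a => c a.succ) (c 0) using 1
        funext a
        refine Fin.cases ?_ (fun a => ?_) a <;> simp
      · rintro ⟨Φ₀, Φ⟩ - ⟨Φ₀', Φ'⟩ - h
        obtain ⟨h1, h2⟩ := Fin.cons_injective2 h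
        dsimp only at h1 h2
        rw [h1, h2]
    set d : (Fin s → V) → Finset V := fun x =>
      Finset.univ.filter fun y => Fin.cons (α := fun _ => V) y x ∈ S with hd
    have hdS : ∑ x, ((d x).card : ℝ) = S.card := by
      rw [← Nat.cast_sum, ← Finset.card_sigma]
      norm_cast
      refine Finset.card_bij (fun p _ => Fin.cons (α := fun _ => V) p.2 p.1) ?_ ?_ ?_
      · rintro ⟨x, y⟩ h
        simpa [hd] using h
      · rintro ⟨x, y⟩ - ⟨x', y'⟩ - h
        obtain ⟨h1, h2⟩ := Fin.cons_injective2 h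
        dsimp only at h1 h2
        rw [h1, h2]
      · intro z hz
        refine ⟨⟨Fin.tail z, z 0⟩, ?_, ?_⟩
        · simpa [hd] using hz
        · simp
    have hsum : ∑ Φ₀, ((S' Φ₀).card : ℝ) = ∑ x, ((d x).card : ℝ) ^ M := by
      have e1 : ∀ Φ₀, ((S' Φ₀).card : ℝ) = ∑ x, if ∀ i, Φ₀ i ∈ d x then (1 : ℝ) else 0 := by
        intro Φ₀
        simp [hS', hd]
      simp_rw [e1]
      rw [Finset.sum_comm]
      refine Finset.sum_congr rfl fun x _ => ?_
      have e2 : (Finset.univ.filter fun Φ₀ : Fin M → V => ∀ i, Φ₀ i ∈ d x)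
          = Fintype.piFinset fun _ => d x := by
        ext; simp
      rw [Finset.sum_boole, e2]
      simp
    have hcV : (Fintype.card (Fin s → V) : ℝ) = n ^ s := by simp [hn]
    have hcM : (Fintype.card (Fin M → V) : ℝ) = n ^ M := by simp [hn]
    have j1 := card_mul_mean_pow_le (fun x : Fin s → V => ((d x).card : ℝ))
      (fun x => Nat.cast_nonneg _) M
    rw [hdS, ← hsum, hcV] at j1
    have j2 := card_mul_mean_pow_le (fun Φ₀ : Fin M → V => ((S' Φ₀).card : ℝ) / n ^ s)
      (fun x => by positivity) (M ^ s)
    rw [← Finset.sum_div, hcM] at j2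
    calc n ^ ((s + 1) * M) * ((S.card : ℝ) / n ^ (s + 1)) ^ (M ^ (s + 1))
        = n ^ (s * M) * (n ^ M * ((((S.card : ℝ) / n ^ s) / n) ^ M) ^ (M ^ s)) := by
          rw [div_div, ← pow_succ, ← pow_mul, ← mul_assoc, ← pow_add, Nat.pow_succ,
            Nat.mul_comm (M ^ s), Nat.succ_mul]
      _ = n ^ (s * M) * (n ^ M * ((n ^ s * ((S.card : ℝ) / n ^ s) ^ M) / n ^ s / n ^ M)
            ^ (M ^ s)) := by
          congr 3
          rw [div_pow _ n]
          field_simp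
      _ ≤ n ^ (s * M) * (n ^ M * ((∑ Φ₀, ((S' Φ₀).card : ℝ)) / n ^ s / n ^ M) ^ (M ^ s)) := by
          gcongr
      _ ≤ n ^ (s * M) * ∑ Φ₀, (((S' Φ₀).card : ℝ) / n ^ s) ^ (M ^ s) := by
          gcongr
      _ = ∑ Φ₀, n ^ (s * M) * (((S' Φ₀).card : ℝ) / n ^ s) ^ (M ^ s) := Finset.mul_sum _ _ _
      _ ≤ ∑ Φ₀, ((blowups (S' Φ₀) M).card : ℝ) := Finset.sum_le_sum fun Φ₀ _ => ih (S' Φ₀)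
      _ ≤ _ := hle

open scoped Classical in
/-- The maps from the vertices of the complete `s`-partite graph with parts of size `M` which are
homomorphisms to `D`. -/
noncomputable def multipartiteHoms (D : SimpleGraph V) (s M : ℕ) : Finset (Fin s × Fin M → V) :=
  Finset.univ.filter fun φ => ∀ x y, x.1 ≠ y.1 → D.Adj (φ x) (φ y)

lemma le_card_multipartiteHoms [Nonempty V] (D : SimpleGraph V) {r : ℕ} (hr : 1 ≤ r) {δ : ℝ}
    (hδ : 0 < δ) (hD : (1 - 1 / (r : ℝ) + δ) * (Fintype.card V : ℝ) ^ 2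
      ≤ (cliqueTuples D 2).card) (M : ℕ) :
    (δ ^ r) ^ (M ^ (r + 1)) * (Fintype.card V : ℝ) ^ ((r + 1) * M)
      ≤ (multipartiteHoms D (r + 1) M).card := by
  classical
  have h1 := pow_mul_le_card_cliqueTuples D hr hδ hD
  have h2 := le_card_blowups (cliqueTuples D (r + 1)) M
  set n : ℝ := (Fintype.card V : ℝ) with hn
  have hn0 : 0 < n := by rw [hn]; exact_mod_cast Fintype.card_pos
  have h3 : (blowups (cliqueTuples D (r + 1)) M).card
      ≤ (multipartiteHoms D (r + 1) M).card := by
    refine Finset.card_le_card_of_injOn (fun Φ x => Φ x.1 x.2) ?_ ?_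
    · intro Φ hΦ
      simp only [blowups, cliqueTuples, Finset.coe_filter, Finset.mem_filter, Finset.mem_univ,
        true_and, Set.mem_ofPred_eq, multipartiteHoms] at hΦ ⊢
      intro x y hxy
      have := hΦ (fun a => if a = x.1 then x.2 else y.2) x.1 y.1 hxy
      simpa [hxy.symm] using this
    · intro Φ _ Φ' _ h
      funext a i
      exact congrFun h (a, i)
  calc (δ ^ r) ^ (M ^ (r + 1)) * n ^ ((r + 1) * M)
      = n ^ ((r + 1) * M) * (δ ^ r * n ^ (r + 1) / n ^ (r + 1)) ^ (M ^ (r + 1)) := by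
        field_simp
    _ ≤ n ^ ((r + 1) * M) *
        (((cliqueTuples D (r + 1)).card : ℝ) / n ^ (r + 1)) ^ (M ^ (r + 1)) := by gcongr
    _ ≤ _ := h2
    _ ≤ _ := by exact_mod_cast h3

end Supersaturation

section Pinning

lemma sum_update_sum {I V : Type*} [Fintype I] [DecidableEq I] [Fintype V] (i : I)
    (K : (I → V) → ℝ) :
    ∑ φ, ∑ x, K (Function.update φ i x) = Fintype.card V * ∑ φ, K φ := by
  have h : ∀ p : (I → V) × V, (Function.update (Function.update p.1 i p.2) i (p.1 i),
      Function.update p.1 i p.2 i) = p := fun p =>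
    Prod.ext (by rw [Function.update_idem, Function.update_eq_self]) (Function.update_self ..)
  let e : (I → V) × V ≃ (I → V) × V :=
    { toFun := fun p => (Function.update p.1 i p.2, p.1 i)
      invFun := fun p => (Function.update p.1 i p.2, p.1 i)
      left_inv := h
      right_inv := h }
  calc ∑ φ, ∑ x, K (Function.update φ i x)
      = ∑ p : (I → V) × V, K (e p).1 :=
        (by rw [Fintype.sum_prod_type]; rfl)
    _ = ∑ p : (I → V) × V, K p.1 := e.sum_comp fun p => K p.1
    _ = _ := by
      rw [Fintype.sum_prod_type]
      simp [Finset.mul_sum]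

lemma exists_pinning {V : Type*} [Fintype V] [DecidableEq V] (E : Finset V → ℝ) {B c : ℝ}
    (h0 : 0 ≤ E ∅) (hE : ∀ W, E W ≤ B) (hc : 0 < c) :
    ∃ W : Finset V, W.card * c ≤ B ∧ ∀ Z, E (W ∪ Z) ≤ E W + Z.card * c := by
  classical
  obtain ⟨W, hW, hmax⟩ := Finset.exists_max_image
    (Finset.univ.filter fun W : Finset V => W.card * c ≤ E W) Finset.card
    ⟨∅, Finset.mem_filter.2 ⟨Finset.mem_univ _, by rwa [Finset.card_empty, Nat.cast_zero, zero_mul]⟩⟩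
  simp only [Finset.mem_filter, Finset.mem_univ, true_and] at hW hmax
  refine ⟨W, hW.trans (hE W), fun Z => ?_⟩
  by_contra! h
  have hcard : ((W ∪ Z).card : ℝ) ≤ W.card + Z.card := by exact_mod_cast Finset.card_union_le W Z
  have h1 : ((W ∪ Z).card : ℝ) * c ≤ E (W ∪ Z) := by nlinarith
  have h2 := Finset.eq_of_subset_of_card_le Finset.subset_union_left (hmax _ h1)
  rw [← h2] at h
  have : 0 ≤ (Z.card : ℝ) * c := mul_nonneg (Nat.cast_nonneg _) hc.le
  linarith

variable {V : Type*}

open scoped Classical in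
/-- The indicator of the adjacency of `x` and `y`. -/
noncomputable def adjIndicator (x y : V) (G : SimpleGraph V) : ℝ :=
  if G.Adj x y then 1 else 0

lemma adjIndicator_nonneg (x y : V) (G : SimpleGraph V) : 0 ≤ adjIndicator x y G := by
  unfold adjIndicator; split_ifs <;> norm_num

lemma adjIndicator_le_one (x y : V) (G : SimpleGraph V) : adjIndicator x y G ≤ 1 := by
  unfold adjIndicator; split_ifs <;> norm_num

lemma adjIndicator_comm (x y : V) (G : SimpleGraph V) :
    adjIndicator x y G = adjIndicator y x G := by
  classical exact if_congr (G.adj_comm x y) rfl rfl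

variable [Fintype V]

open scoped Classical in
/-- The edges of `G` incident to `W`, as ordered pairs. -/
noncomputable def fingerprint (W : Finset V) (G : SimpleGraph V) : Finset (V × V) :=
  (W ×ˢ Finset.univ).filter fun p => G.Adj p.1 p.2

lemma fingerprint_eq_iff {W : Finset V} {G H : SimpleGraph V} :
    fingerprint W G = fingerprint W H ↔ ∀ x ∈ W, ∀ y, G.Adj x y ↔ H.Adj x y := by
  simp only [fingerprint, Finset.ext_iff, Finset.mem_filter, Finset.mem_product, Finset.mem_univ,
    and_true, Prod.forall]
  exact ⟨fun h x hx y => by simpa [hx] using h x y, fun h x y => and_congr_right fun hx => h x hx y⟩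

lemma fingerprint_mono {W W' : Finset V} (hW : W ⊆ W') {G H : SimpleGraph V}
    (h : fingerprint W' G = fingerprint W' H) : fingerprint W G = fingerprint W H :=
  fingerprint_eq_iff.2 fun x hx => fingerprint_eq_iff.1 h x (hW hx)

lemma adj_iff_of_fingerprint_eq {W : Finset V} {G H : SimpleGraph V}
    (h : fingerprint W G = fingerprint W H) {x y : V} (hxy : x ∈ W ∨ y ∈ W) :
    G.Adj x y ↔ H.Adj x y := by
  rcases hxy with hx | hy
  · exact fingerprint_eq_iff.1 h x hx y
  · rw [G.adj_comm, H.adj_comm]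
    exact fingerprint_eq_iff.1 h y hy x

variable {𝒜 : Set (SimpleGraph V)} [Fintype 𝒜]

/-- The probability that `x` and `y` are adjacent in a random graph of `𝒜` with the same edges
incident to `W` as `G`. -/
noncomputable def adjProb (W : Finset V) (x y : V) (G : 𝒜) : ℝ :=
  cellAverage (fun G : 𝒜 => fingerprint W G.1) (fun G => adjIndicator x y G.1) G

lemma adjProb_nonneg (W : Finset V) (x y : V) (G : 𝒜) : 0 ≤ adjProb W x y G := by
  rw [← cellAverage_const (fun G : 𝒜 => fingerprint W G.1) 0 G, adjProb]
  exact cellAverage_mono _ (fun G : 𝒜 => adjIndicator_nonneg x y G.1) _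

lemma adjProb_le_one (W : Finset V) (x y : V) (G : 𝒜) : adjProb W x y G ≤ 1 := by
  rw [← cellAverage_const (fun G : 𝒜 => fingerprint W G.1) 1 G, adjProb]
  exact cellAverage_mono _ (fun G : 𝒜 => adjIndicator_le_one x y G.1) _

lemma adjProb_comm (W : Finset V) (x y : V) (G : 𝒜) : adjProb W x y G = adjProb W y x G := by
  simp only [adjProb, adjIndicator_comm x y]

lemma exists_pinned_set [DecidableEq V] [Nonempty V] [Nonempty 𝒜] {η : ℝ} (hη : 0 < η) :
    ∃ W : Finset V, W.card * η ^ 2 ≤ 1 ∧ ∀ Z : Finset V,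
      ∑ x, ∑ y, ∑ G : 𝒜, |adjProb (W ∪ Z) x y G - adjProb W x y G|
        ≤ Z.card * ((Fintype.card V : ℝ) ^ 2 * Fintype.card 𝒜 * η) := by
  have hn : (0 : ℝ) < Fintype.card V := by exact_mod_cast Fintype.card_pos
  have hA : (0 : ℝ) < Fintype.card 𝒜 := by exact_mod_cast Fintype.card_pos
  set B : ℝ := (Fintype.card V : ℝ) ^ 2 * Fintype.card 𝒜 with hB
  have hB0 : 0 < B := by positivity
  obtain ⟨W, hW, hZ⟩ := exists_pinning (B := B) (c := B * η ^ 2)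
    (fun W => ∑ x : V, ∑ y : V, ∑ G : 𝒜, adjProb W x y G ^ 2)
    (Finset.sum_nonneg fun x _ => Finset.sum_nonneg fun y _ => Finset.sum_nonneg fun G _ =>
      sq_nonneg _)
    (fun W => by
      calc ∑ x : V, ∑ y : V, ∑ G : 𝒜, adjProb W x y G ^ 2
          ≤ ∑ x : V, ∑ y : V, ∑ G : 𝒜, (1 : ℝ) := by
            gcongr with x _ y _ G
            exact pow_le_one₀ (adjProb_nonneg W x y G) (adjProb_le_one W x y G)
        _ = B := by simp [hB]; ring)
    (by positivity)
  refine ⟨W, ?_, fun Z => ?_⟩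
  · refine le_of_mul_le_mul_left ?_ hB0
    linarith
  · have h1 : ∑ x : V, ∑ y : V, ∑ G : 𝒜, (adjProb (W ∪ Z) x y G - adjProb W x y G) ^ 2
        ≤ Z.card * (B * η ^ 2) := by
      have e : ∀ x y : V, ∑ G : 𝒜, (adjProb (W ∪ Z) x y G - adjProb W x y G) ^ 2
          = ∑ G : 𝒜, adjProb (W ∪ Z) x y G ^ 2 - ∑ G : 𝒜, adjProb W x y G ^ 2 := fun x y =>
        sum_sq_cellAverage_sub (fun G H h => fingerprint_mono Finset.subset_union_left h) _
      simp_rw [e, Finset.sum_sub_distrib]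
      linarith [hZ Z]
    have h2 : (∑ x : V, ∑ y : V, ∑ G : 𝒜, |adjProb (W ∪ Z) x y G - adjProb W x y G|) ^ 2
        ≤ B * ∑ x : V, ∑ y : V, ∑ G : 𝒜, (adjProb (W ∪ Z) x y G - adjProb W x y G) ^ 2 := by
      have := sq_sum_le_card_mul_sum_sq (s := (Finset.univ : Finset (V × V × 𝒜)))
        (f := fun p => |adjProb (W ∪ Z) p.1 p.2.1 p.2.2 - adjProb W p.1 p.2.1 p.2.2|)
      simp only [Fintype.sum_prod_type, sq_abs, Finset.card_univ, Fintype.card_prod] at this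
      refine this.trans (le_of_eq ?_)
      rw [hB]
      push_cast
      ring
    refine abs_le_of_sq_le_sq' (h2.trans ?_) (by positivity) |>.2
    have hz : (Z.card : ℝ) ≤ (Z.card : ℝ) ^ 2 := by
      norm_cast
      exact Nat.le_self_pow two_ne_zero _
    calc _ ≤ B * (Z.card * (B * η ^ 2)) := by gcongr
      _ ≤ B * (Z.card ^ 2 * (B * η ^ 2)) := by gcongr
      _ = _ := by ring

variable [DecidableEq V] {I : Type*} [Fintype I] [DecidableEq I]

/-- How much the edges incident to the other entries of `φ` help to predict whether `φ i` and
`φ j` are adjacent. -/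
noncomputable def predictionGain (W : Finset V) (φ : I → V) (i j : I) (G : 𝒜) : ℝ :=
  |adjProb (W ∪ ((Finset.univ.erase i).erase j).image φ) (φ i) (φ j) G
    - adjProb W (φ i) (φ j) G|

lemma sum_predictionGain_le [Nonempty V] {W : Finset V} {η : ℝ} (hη : 0 < η)
    (hW : ∀ Z : Finset V, ∑ x, ∑ y, ∑ G : 𝒜, |adjProb (W ∪ Z) x y G - adjProb W x y G|
      ≤ Z.card * ((Fintype.card V : ℝ) ^ 2 * Fintype.card 𝒜 * η)) {i j : I} (hij : i ≠ j) :
    ∑ φ : I → V, ∑ G : 𝒜, predictionGain W φ i j G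
      ≤ Fintype.card I * ((Fintype.card V : ℝ) ^ Fintype.card I * Fintype.card 𝒜 * η) := by
  have hn : (0 : ℝ) < Fintype.card V := by exact_mod_cast Fintype.card_pos
  set K : (I → V) → ℝ := fun φ => ∑ G : 𝒜, predictionGain W φ i j G with hK
  have h1 : ∀ φ : I → V, ∑ x, ∑ y, K (Function.update (Function.update φ i x) j y)
      ≤ Fintype.card I * ((Fintype.card V : ℝ) ^ 2 * Fintype.card 𝒜 * η) := by
    intro φ
    set Z := ((Finset.univ.erase i).erase j).image φ with hZ
    have e : ∀ x y, K (Function.update (Function.update φ i x) j y)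
        = ∑ G : 𝒜, |adjProb (W ∪ Z) x y G - adjProb W x y G| := by
      intro x y
      refine Finset.sum_congr rfl fun G _ => ?_
      have e1 : ((Finset.univ.erase i).erase j).image
          (Function.update (Function.update φ i x) j y) = Z := by
        refine Finset.image_congr fun a ha => ?_
        simp only [Finset.coe_erase, Finset.coe_univ, Set.mem_sdiff, Set.mem_univ, true_and,
          Set.mem_singleton_iff] at ha
        rw [Function.update_of_ne ha.2, Function.update_of_ne ha.1]
      rw [predictionGain, e1, Function.update_self, Function.update_of_ne hij,
        Function.update_self]
    simp_rw [e]
    refine (hW Z).trans ?_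
    gcongr
    exact Finset.card_image_le.trans (Finset.card_le_univ _)
  have h2 : (Fintype.card V : ℝ) ^ 2 * ∑ φ, K φ
      = ∑ φ : I → V, ∑ x, ∑ y, K (Function.update (Function.update φ i x) j y) := by
    rw [sum_update_sum i fun φ => ∑ y, K (Function.update φ j y), sum_update_sum j K]
    ring
  refine le_of_mul_le_mul_left (a := (Fintype.card V : ℝ) ^ 2) ?_ (by positivity)
  rw [h2]
  refine (Finset.sum_le_sum fun φ _ => h1 φ).trans (le_of_eq ?_)
  simp only [Finset.sum_const, Finset.card_univ, Fintype.card_pi, Finset.prod_const, nsmul_eq_mul]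
  push_cast
  ring

end Pinning

section Independence

variable {V : Type*} [Fintype V] [DecidableEq V] {I : Type*} [Fintype I] [DecidableEq I]

lemma pow_le_sum_cellAverage_predictionGain {𝒜 : Set (SimpleGraph V)} [Fintype 𝒜] (W : Finset V)
    {N : ℕ} (ψ : Fin N ↪ I) (φ : I → V) {F : SimpleGraph (Fin N)}
    (hF : ∀ G ∈ 𝒜, SimpleGraph.comap (φ ∘ ψ) G ≠ F) {τ : ℝ} (h0 : 0 ≤ τ) (h1 : τ ≤ 1) (G : 𝒜)
    (hadj : ∀ u u', F.Adj u u' → τ ≤ adjProb W (φ (ψ u)) (φ (ψ u')) G)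
    (hnadj : ∀ u u', u ≠ u' → ¬ F.Adj u u' → adjProb W (φ (ψ u)) (φ (ψ u')) G ≤ 1 - τ) :
    τ ^ (Fintype.card I ^ 2) ≤ ∑ p ∈ (Finset.univ : Finset (I × I)).filter (fun p => p.1 ≠ p.2),
      cellAverage (fun G : 𝒜 => fingerprint W G.1) (predictionGain W φ p.1 p.2) G := by
  classical
  set f : 𝒜 → Finset (V × V) := fun G => fingerprint W G.1 with hf
  set s : Finset (Fin N × Fin N) := Finset.univ.filter fun e => e.1 < e.2 with hs
  set W' : Fin N × Fin N → Finset V := fun e =>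
    W ∪ ((Finset.univ.erase (ψ e.1)).erase (ψ e.2)).image φ with hW'
  set X : Fin N × Fin N → 𝒜 → ℝ := fun e H =>
    if F.Adj e.1 e.2 then adjIndicator (φ (ψ e.1)) (φ (ψ e.2)) H.1
    else 1 - adjIndicator (φ (ψ e.1)) (φ (ψ e.2)) H.1 with hX
  have hX01 : ∀ e H, 0 ≤ X e H ∧ X e H ≤ 1 := by
    intro e H
    have a0 := adjIndicator_nonneg (φ (ψ e.1)) (φ (ψ e.2)) H.1
    have a1 := adjIndicator_le_one (φ (ψ e.1)) (φ (ψ e.2)) H.1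
    simp only [hX]
    split_ifs <;> constructor <;> linarith
  have hprod : ∀ H : 𝒜, ∏ e ∈ s, X e H = 0 := by
    intro H
    by_contra hne
    rw [← ne_eq, Finset.prod_ne_zero_iff] at hne
    have key : ∀ u u', u < u' → (H.1.Adj (φ (ψ u)) (φ (ψ u')) ↔ F.Adj u u') := by
      intro u u' huu
      have := hne (u, u') (by simpa [hs] using huu)
      simp only [hX, adjIndicator] at this
      by_cases hFa : F.Adj u u' <;> by_cases hHa : H.1.Adj (φ (ψ u)) (φ (ψ u')) <;>
        simp [hFa, hHa] at this ⊢
    refine hF H.1 H.2 (SimpleGraph.ext ?_)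
    funext u u'
    rcases lt_trichotomy u u' with h | rfl | h
    · exact propext (key u u' h)
    · simp
    · refine propext ?_
      rw [F.adj_comm, SimpleGraph.adj_comm]
      exact key u' u h
  have hcell : ∀ (g : 𝒜 → Finset (V × V)) e H, cellAverage g (X e) H
      = if F.Adj e.1 e.2 then
          cellAverage g (fun H => adjIndicator (φ (ψ e.1)) (φ (ψ e.2)) H.1) H
        else 1 - cellAverage g (fun H => adjIndicator (φ (ψ e.1)) (φ (ψ e.2)) H.1) H := by
    intro g e H
    simp only [hX]
    split_ifs with h
    · rfl
    · rw [cellAverage_sub, cellAverage_const]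
  have hmain := abs_cellAverage_prod_sub_le s f (fun e (H : 𝒜) => fingerprint (W' e) H.1) X
    (fun e _ H H' h => fingerprint_mono Finset.subset_union_left h)
    (fun e _ H => (hX01 e H).1) (fun e _ H => (hX01 e H).2) (by
      rintro ⟨u, u'⟩ he ⟨v, v'⟩ he' hne H H' h
      simp only [hs, Finset.mem_filter, Finset.mem_univ, true_and] at he he'
      have hmem : ∀ w, w ≠ u → w ≠ u' → φ (ψ w) ∈ W' (u, u') := fun w h1 h2 =>
        Finset.mem_union_right _ (Finset.mem_image_of_mem _ (by simp [h1, h2]))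
      have hor : φ (ψ v) ∈ W' (u, u') ∨ φ (ψ v') ∈ W' (u, u') := by
        by_contra hcon
        rw [not_or] at hcon
        have c1 : v = u ∨ v = u' := by
          by_contra c; rw [not_or] at c; exact hcon.1 (hmem v c.1 c.2)
        have c2 : v' = u ∨ v' = u' := by
          by_contra c; rw [not_or] at c; exact hcon.2 (hmem v' c.1 c.2)
        rcases c1 with rfl | rfl <;> rcases c2 with rfl | rfl
        · exact lt_irrefl _ he'
        · exact hne rfl
        · exact lt_asymm he he'
        · exact lt_irrefl _ he'
      have := adj_iff_of_fingerprint_eq h hor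
      simp only [hX, adjIndicator, this]) G
  simp only [hprod, cellAverage_const, zero_sub, abs_neg] at hmain
  have hXτ : ∀ e ∈ s, τ ≤ cellAverage f (X e) G := by
    intro e he
    rw [hcell]
    split_ifs with h
    · exact hadj _ _ h
    · have := hnadj e.1 e.2 (by simp only [hs, Finset.mem_filter] at he; exact he.2.ne) h
      rw [adjProb] at this
      linarith
  have hcard : s.card ≤ Fintype.card I ^ 2 := by
    have hN : N ≤ Fintype.card I := by simpa using Fintype.card_le_of_embedding ψ
    calc s.card ≤ Fintype.card (Fin N × Fin N) := Finset.card_le_univ _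
      _ = N ^ 2 := by simp [sq]
      _ ≤ _ := by gcongr
  have hgain : ∀ e, (fun H => |cellAverage (fun (H : 𝒜) => fingerprint (W' e) H.1) (X e) H
      - cellAverage f (X e) H|) = predictionGain (𝒜 := 𝒜) W φ (ψ e.1) (ψ e.2) := by
    intro e
    funext H
    rw [hcell, hcell, predictionGain, adjProb, adjProb]
    split_ifs
    · rfl
    · rw [abs_sub_comm]
      congr 1
      ring
  simp only [hgain] at hmain
  have hpos : ∀ p : I × I, 0 ≤ cellAverage f (predictionGain W φ p.1 p.2) G := fun p => by
    rw [← cellAverage_const f 0 G]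
    exact cellAverage_mono _ (fun H => abs_nonneg _) _
  calc τ ^ (Fintype.card I ^ 2) ≤ τ ^ s.card := pow_le_pow_of_le_one h0 h1 hcard
    _ = ∏ e ∈ s, τ := by simp
    _ ≤ ∏ e ∈ s, cellAverage f (X e) G := Finset.prod_le_prod (fun _ _ => h0) hXτ
    _ ≤ _ := (le_abs_self _).trans hmain
    _ = ∑ p ∈ s.image (fun e => (ψ e.1, ψ e.2)),
          cellAverage f (predictionGain W φ p.1 p.2) G := by
        rw [Finset.sum_image]
        rintro ⟨a, b⟩ - ⟨c, d⟩ - h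
        simp only [Prod.mk.injEq, EmbeddingLike.apply_eq_iff_eq] at h
        rw [h.1, h.2]
    _ ≤ _ := by
        refine Finset.sum_le_sum_of_subset_of_nonneg ?_ fun p _ _ => hpos p
        intro p hp
        simp only [Finset.mem_image, hs, Finset.mem_filter, Finset.mem_univ, true_and] at hp ⊢
        obtain ⟨e, he, rfl⟩ := hp
        simpa using he.ne

/-- The pairs whose adjacency is not nearly determined by the edges of `G` incident to `W`. -/
noncomputable def undecided {𝒜 : Set (SimpleGraph V)} [Fintype 𝒜] (W : Finset V) (τ : ℝ) (G : 𝒜) :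
    SimpleGraph V where
  Adj x y := x ≠ y ∧ τ ≤ adjProb W x y G ∧ adjProb W x y G ≤ 1 - τ
  symm := ⟨fun x y h => by rw [adjProb_comm]; exact ⟨h.1.symm, h.2⟩⟩
  loopless := ⟨fun x h => h.1 rfl⟩

lemma card_mul_le_of_multipartiteHoms {n : ℕ} [NeZero n] {P : ∀ n, Set (SimpleGraph (Fin n))}
    (hP : IsHereditary P) [Fintype (P n)] {s M : ℕ}
    (hobs : ∀ col : Fin s × Fin M → Fin s × Fin M → Bool, (∀ x y, col x y = col y x) →
      ∃ (N : ℕ) (ψ : Fin N ↪ Fin s × Fin M) (F : SimpleGraph (Fin N)), F ∉ P N ∧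
        ∀ u u', u ≠ u' → (ψ u).1 = (ψ u').1 → (F.Adj u u' ↔ col (ψ u) (ψ u') = true))
    {W : Finset (Fin n)} {η : ℝ} (hη : 0 < η)
    (hW : ∀ Z : Finset (Fin n), ∑ x, ∑ y, ∑ G : P n, |adjProb (W ∪ Z) x y G - adjProb W x y G|
      ≤ Z.card * ((Fintype.card (Fin n) : ℝ) ^ 2 * Fintype.card (P n) * η))
    {τ : ℝ} (h0 : 0 ≤ τ) (h1 : τ ≤ 1 / 2) (bad : Finset (P n)) {m : ℝ}
    (hbad : ∀ G ∈ bad, m ≤ ((multipartiteHoms (undecided W τ G) s M).filter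
      fun φ => Function.Injective φ).card) :
    bad.card * (m * τ ^ ((s * M) ^ 2))
      ≤ ((s * M : ℕ) : ℝ) ^ 3 * ((n : ℝ) ^ (s * M) * Fintype.card (P n) * η) := by
  classical
  have hI : Fintype.card (Fin s × Fin M) = s * M := by simp
  set S : (Fin s × Fin M → Fin n) → P n → ℝ := fun φ G =>
    ∑ p ∈ (Finset.univ : Finset ((Fin s × Fin M) × (Fin s × Fin M))).filter (fun p => p.1 ≠ p.2),
      cellAverage (fun G : P n => fingerprint W G.1) (predictionGain W φ p.1 p.2) G with hS
  have hS0 : ∀ φ G, 0 ≤ S φ G := fun φ G => Finset.sum_nonneg fun p _ => by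
    rw [← cellAverage_const (fun G : P n => fingerprint W G.1) 0 G]
    exact cellAverage_mono _ (fun H => abs_nonneg _) _
  have key : ∀ G ∈ bad, m * τ ^ ((s * M) ^ 2) ≤ ∑ φ, S φ G := by
    intro G hG
    set T := (multipartiteHoms (undecided W τ G) s M).filter fun φ => Function.Injective φ with hT
    have hφ : ∀ φ ∈ T, τ ^ ((s * M) ^ 2) ≤ S φ G := by
      intro φ hφ
      simp only [hT, multipartiteHoms, Finset.mem_filter, Finset.mem_univ, true_and] at hφ
      obtain ⟨hhom, hinj⟩ := hφ
      obtain ⟨N, ψ, F, hF, hcol⟩ := hobs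
        (fun x y => decide (1 / 2 ≤ adjProb W (φ x) (φ y) G))
        (fun x y => by rw [adjProb_comm])
      rw [← hI]
      refine pow_le_sum_cellAverage_predictionGain W ψ φ (F := F) (fun H hH hHF => hF ?_) h0
        (by linarith) G (fun u u' h => ?_) (fun u u' hne h => ?_)
      · rw [← hHF]
        exact hP (ψ.trans ⟨φ, hinj⟩) H hH
      · by_cases hp : (ψ u).1 = (ψ u').1
        · have := (hcol u u' h.ne hp).1 h
          simp only [decide_eq_true_eq] at this
          linarith
        · exact (hhom _ _ hp).2.1
      · by_cases hp : (ψ u).1 = (ψ u').1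
        · have := mt (hcol u u' hne hp).2 h
          simp only [decide_eq_true_eq] at this
          linarith
        · exact (hhom _ _ hp).2.2
    calc m * τ ^ ((s * M) ^ 2) ≤ T.card * τ ^ ((s * M) ^ 2) := by
          gcongr
          exact hbad G hG
      _ = ∑ φ ∈ T, τ ^ ((s * M) ^ 2) := by simp
      _ ≤ ∑ φ ∈ T, S φ G := Finset.sum_le_sum hφ
      _ ≤ ∑ φ, S φ G := Finset.sum_le_univ_sum_of_nonneg fun φ => hS0 φ G
  calc bad.card * (m * τ ^ ((s * M) ^ 2)) = ∑ G ∈ bad, m * τ ^ ((s * M) ^ 2) := by simp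
    _ ≤ ∑ G ∈ bad, ∑ φ, S φ G := Finset.sum_le_sum key
    _ ≤ ∑ G, ∑ φ, S φ G := Finset.sum_le_univ_sum_of_nonneg fun G =>
        Finset.sum_nonneg fun φ _ => hS0 φ G
    _ = ∑ p ∈ (Finset.univ : Finset ((Fin s × Fin M) × (Fin s × Fin M))).filter
          (fun p => p.1 ≠ p.2), ∑ φ, ∑ G, predictionGain W φ p.1 p.2 G := by
        rw [Finset.sum_comm]
        simp only [hS]
        rw [Finset.sum_congr rfl fun φ _ => Finset.sum_comm, Finset.sum_comm]
        refine Finset.sum_congr rfl fun p _ => Finset.sum_congr rfl fun φ _ => ?_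
        exact sum_cellAverage _ _
    _ ≤ ∑ p ∈ (Finset.univ : Finset ((Fin s × Fin M) × (Fin s × Fin M))).filter
          (fun p => p.1 ≠ p.2), ((s * M : ℕ) : ℝ) *
            ((n : ℝ) ^ (s * M) * Fintype.card (P n) * η) := by
        refine Finset.sum_le_sum fun p hp => ?_
        have := sum_predictionGain_le hη hW (I := Fin s × Fin M) (Finset.mem_filter.1 hp).2
        rw [hI] at this
        simpa using this
    _ ≤ ∑ p : (Fin s × Fin M) × (Fin s × Fin M), ((s * M : ℕ) : ℝ) *
            ((n : ℝ) ^ (s * M) * Fintype.card (P n) * η) :=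
        Finset.sum_le_univ_sum_of_nonneg fun p => by positivity
    _ = _ := by
        simp only [Finset.sum_const, Finset.card_univ, Fintype.card_prod, Fintype.card_fin,
          nsmul_eq_mul]
        push_cast
        ring

lemma card_filter_not_injective_le {n : ℕ} :
    (((Finset.univ : Finset (I → Fin n)).filter fun φ => ¬ Function.Injective φ).card : ℝ) * n
      ≤ (Fintype.card I : ℝ) ^ 2 * (n : ℝ) ^ Fintype.card I := by
  classical
  have h1 : ∀ p : I × I, p.1 ≠ p.2 →
      ((Finset.univ.filter fun φ : I → Fin n => φ p.1 = φ p.2).card : ℝ) * n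
        ≤ (n : ℝ) ^ Fintype.card I := by
    intro p hp
    have := sum_update_sum p.1 fun φ : I → Fin n => if φ p.1 = φ p.2 then (1 : ℝ) else 0
    simp only [Function.update_self, Function.update_of_ne hp.symm] at this
    rw [Finset.sum_boole, Fintype.card_fin] at this
    rw [mul_comm, ← this]
    simp
  have h2 : (Finset.univ : Finset (I → Fin n)).filter (fun φ => ¬ Function.Injective φ)
      ⊆ ((Finset.univ : Finset (I × I)).filter fun p => p.1 ≠ p.2).biUnion
        fun p => Finset.univ.filter fun φ : I → Fin n => φ p.1 = φ p.2 := by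
    intro φ hφ
    obtain ⟨a, b, h, hne⟩ := Function.not_injective_iff.1 (Finset.mem_filter.1 hφ).2
    exact Finset.mem_biUnion.2 ⟨(a, b), by simpa using hne, by simpa using h⟩
  calc _ ≤ ((((Finset.univ : Finset (I × I)).filter fun p => p.1 ≠ p.2).biUnion
        fun p => Finset.univ.filter fun φ : I → Fin n => φ p.1 = φ p.2).card : ℝ) * n := by
        gcongr
    _ ≤ (∑ p ∈ (Finset.univ : Finset (I × I)).filter fun p => p.1 ≠ p.2,
        ((Finset.univ.filter fun φ : I → Fin n => φ p.1 = φ p.2).card : ℝ)) * n := by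
        gcongr
        exact_mod_cast Finset.card_biUnion_le
    _ = ∑ p ∈ (Finset.univ : Finset (I × I)).filter fun p => p.1 ≠ p.2,
        ((Finset.univ.filter fun φ : I → Fin n => φ p.1 = φ p.2).card : ℝ) * n :=
        Finset.sum_mul _ _ _
    _ ≤ ∑ p ∈ (Finset.univ : Finset (I × I)).filter fun p => p.1 ≠ p.2,
        (n : ℝ) ^ Fintype.card I :=
        Finset.sum_le_sum fun p hp => h1 p (Finset.mem_filter.1 hp).2
    _ ≤ ∑ p : I × I, (n : ℝ) ^ Fintype.card I :=
        Finset.sum_le_univ_sum_of_nonneg fun p => by positivity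
    _ = _ := by
        simp only [Finset.sum_const, Finset.card_univ, Fintype.card_prod, nsmul_eq_mul]
        push_cast
        ring

end Independence

section Counting

lemma cellAverage_le_cellAverage_of_cell {Ω β : Type*} [Fintype Ω] (f : Ω → β) {X Y : Ω → ℝ}
    {ω : Ω} (h : ∀ ω', f ω' = f ω → X ω' ≤ Y ω') : cellAverage f X ω ≤ cellAverage f Y ω := by
  unfold cellAverage
  gcongr with ω' hω'
  exact h ω' (mem_cell.1 hω')

lemma card_filter_card_le {α : Type*} [Fintype α] [DecidableEq α] (q : ℕ) :
    ((Finset.univ : Finset (Finset α)).filter fun s => s.card ≤ q).card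
      ≤ (Fintype.card α + 1) ^ q := by
  classical
  have h : ((Finset.univ : Finset (Finset α)).filter fun s => s.card ≤ q)
      ⊆ (Finset.univ : Finset (Fin q → Option α)).image
        fun g => Finset.univ.filter fun a => ∃ i, g i = some a := by
    intro s hs
    have hs : s.card ≤ q := by simpa using hs
    obtain ⟨e⟩ : Nonempty (s ↪ Fin q) :=
      Function.Embedding.nonempty_of_card_le (by simpa using hs)
    refine Finset.mem_image.2 ⟨fun i => if h : ∃ a : s, e a = i then some h.choose.1 else none,
      Finset.mem_univ _, ?_⟩
    ext a
    simp only [Finset.mem_filter, Finset.mem_univ, true_and]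
    constructor
    · rintro ⟨i, hi⟩
      split_ifs at hi with h
      rw [← Option.some.inj hi]
      exact h.choose.2
    · intro ha
      have hex : ∃ b : s, e b = e ⟨a, ha⟩ := ⟨_, rfl⟩
      refine ⟨e ⟨a, ha⟩, ?_⟩
      rw [dif_pos hex, e.injective hex.choose_spec]
  calc _ ≤ _ := Finset.card_le_card h
    _ ≤ _ := Finset.card_image_le
    _ = _ := by simp

lemma two_mul_card_filter_lt_le {n : ℕ} (D : SimpleGraph (Fin n)) [DecidableRel D.Adj] :
    2 * (Finset.univ.filter fun p : Fin n × Fin n => p.1 < p.2 ∧ D.Adj p.1 p.2).card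
      ≤ (cliqueTuples D 2).card := by
  classical
  set U := Finset.univ.filter fun p : Fin n × Fin n => p.1 < p.2 ∧ D.Adj p.1 p.2 with hU
  have hdisj : Disjoint (U.image fun p => ![p.1, p.2]) (U.image fun p => ![p.2, p.1]) := by
    rw [Finset.disjoint_left]
    intro x hx hx'
    simp only [Finset.mem_image, hU, Finset.mem_filter, Finset.mem_univ, true_and] at hx hx'
    obtain ⟨p, hp, rfl⟩ := hx
    obtain ⟨p', hp', h⟩ := hx'
    have h0 := congrFun h 0
    have h1 := congrFun h 1
    simp only [Matrix.cons_val_zero, Matrix.cons_val_one] at h0 h1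
    rw [h0, h1] at hp'
    exact lt_asymm hp.1 hp'.1
  have hc1 : (U.image fun p => ![p.1, p.2]).card = U.card :=
    Finset.card_image_of_injective _ fun p p' h =>
      Prod.ext (congrFun h 0) (congrFun h 1)
  have hc2 : (U.image fun p => ![p.2, p.1]).card = U.card :=
    Finset.card_image_of_injective _ fun p p' h =>
      Prod.ext (congrFun h 1) (congrFun h 0)
  have hsub : (U.image fun p => ![p.1, p.2]) ∪ (U.image fun p => ![p.2, p.1])
      ⊆ cliqueTuples D 2 := by
    intro x hx
    simp only [Finset.mem_union, Finset.mem_image, hU, Finset.mem_filter, Finset.mem_univ,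
      true_and, cliqueTuples] at hx ⊢
    rcases hx with ⟨p, hp, rfl⟩ | ⟨p, hp, rfl⟩ <;> intro a b hab <;> fin_cases a <;>
      fin_cases b <;> simp [hp.2, hp.2.symm] at hab ⊢
  have := Finset.card_le_card hsub
  rw [Finset.card_union_of_disjoint hdisj, hc1, hc2] at this
  omega

variable {V : Type*} [Fintype V] {𝒜 : Set (SimpleGraph V)} [Fintype 𝒜]

lemma adjProb_congr {W : Finset V} {G H : 𝒜} (h : fingerprint W G.1 = fingerprint W H.1)
    (x y : V) : adjProb W x y G = adjProb W x y H :=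
  cellAverage_factorsThrough (fun G : 𝒜 => fingerprint W G.1) _ h

lemma undecided_congr {W : Finset V} {τ : ℝ} {G H : 𝒜}
    (h : fingerprint W G.1 = fingerprint W H.1) : undecided W τ G = undecided W τ H := by
  ext x y
  simp only [undecided, adjProb_congr h]

variable [DecidableEq V]

open scoped Classical in
/-- The pairs whose adjacency in `G` is nearly determined by the edges of `G` incident to `W`, but
not what these edges suggest. -/
noncomputable def exceptional (W : Finset V) (τ : ℝ) (G : 𝒜) : Finset (V × V) :=
  Finset.univ.filter fun p => p.1 ≠ p.2 ∧ ¬ (undecided W τ G).Adj p.1 p.2 ∧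
    ¬ (G.1.Adj p.1 p.2 ↔ 1 / 2 ≤ adjProb W p.1 p.2 G)

lemma sum_card_exceptional_le (W : Finset V) {τ : ℝ} (h0 : 0 ≤ τ) (h1 : τ ≤ 1 / 2) :
    ∑ G : 𝒜, ((exceptional W τ G).card : ℝ)
      ≤ τ * (Fintype.card V : ℝ) ^ 2 * Fintype.card 𝒜 := by
  classical
  have hle : ∀ (p : V × V) (G : 𝒜), cellAverage (fun G : 𝒜 => fingerprint W G.1)
      (fun G => if p ∈ exceptional W τ G then (1 : ℝ) else 0) G ≤ τ := by
    rintro ⟨x, y⟩ G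
    simp only [exceptional, Finset.mem_filter, Finset.mem_univ, true_and]
    by_cases hd : x = y ∨ (undecided W τ G).Adj x y
    · refine (cellAverage_le_cellAverage_of_cell _ (Y := fun _ => 0) fun H hH => ?_).trans
        (by rwa [cellAverage_const])
      rw [if_neg]
      rw [undecided_congr hH]
      tauto
    · rw [not_or] at hd
      obtain ⟨hxy, hund⟩ := hd
      by_cases hp : adjProb W x y G < τ
      · refine le_trans (cellAverage_le_cellAverage_of_cell _
          (Y := fun G : 𝒜 => adjIndicator x y G.1) fun H hH => ?_) hp.le
        have hH' := adjProb_congr hH x y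
        have : ¬ (1 / 2 ≤ adjProb W x y H) := by rw [hH']; linarith
        simp only [this, adjIndicator, iff_false, not_not]
        split_ifs <;> first | tauto | norm_num
      · have hp' : 1 - τ < adjProb W x y G := by
          by_contra hcon
          exact hund ⟨hxy, not_lt.1 hp, not_lt.1 hcon⟩
        refine le_trans (cellAverage_le_cellAverage_of_cell _
          (Y := fun G : 𝒜 => 1 - adjIndicator x y G.1) fun H hH => ?_) ?_
        · have hH' := adjProb_congr hH x y
          have : 1 / 2 ≤ adjProb W x y H := by rw [hH']; linarith
          simp only [this, adjIndicator, iff_true]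
          split_ifs <;> first | tauto | norm_num
        · rw [cellAverage_sub, cellAverage_const]
          rw [adjProb] at hp'
          linarith
  have hcard : ∀ G : 𝒜, ((exceptional W τ G).card : ℝ)
      = ∑ p : V × V, if p ∈ exceptional W τ G then (1 : ℝ) else 0 := by
    intro G; simp
  simp_rw [hcard]
  rw [Finset.sum_comm]
  calc _ = ∑ p : V × V, ∑ G : 𝒜, cellAverage (fun G : 𝒜 => fingerprint W G.1)
        (fun G => if p ∈ exceptional W τ G then (1 : ℝ) else 0) G :=
        Finset.sum_congr rfl fun p _ => (sum_cellAverage _ _).symm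
    _ ≤ ∑ p : V × V, ∑ G : 𝒜, τ :=
        Finset.sum_le_sum fun p _ => Finset.sum_le_sum fun G _ => hle p G
    _ = _ := by
        simp only [Finset.sum_const, Finset.card_univ, Fintype.card_prod, nsmul_eq_mul]
        push_cast
        ring

lemma card_le_of_undecided_of_exceptional {n : ℕ} {𝒜 : Set (SimpleGraph (Fin n))} [Fintype 𝒜]
    (good : Finset 𝒜) (W : Finset (Fin n)) (τ : ℝ) {u q : ℕ}
    (hu : ∀ G ∈ good, (cliqueTuples (undecided W τ G) 2).card ≤ 2 * u + 1)
    (hq : ∀ G ∈ good, (exceptional W τ G).card ≤ q) :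
    good.card ≤ 2 ^ u * (n ^ 2 + 1) ^ q * 2 ^ (W.card * n) := by
  classical
  have himg : (good.image fun G => fingerprint W G.1).card ≤ 2 ^ (W.card * n) := by
    calc _ ≤ (W ×ˢ (Finset.univ : Finset (Fin n))).powerset.card := by
          refine Finset.card_le_card fun s hs => ?_
          obtain ⟨G, -, rfl⟩ := Finset.mem_image.1 hs
          exact Finset.mem_powerset.2 (Finset.filter_subset _ _)
      _ = _ := by simp
  refine (Finset.card_le_mul_card_image (f := fun G : 𝒜 => fingerprint W G.1) good
    (2 ^ u * (n ^ 2 + 1) ^ q) fun a ha => ?_).trans (by gcongr)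
  obtain ⟨G₀, hG₀, rfl⟩ := Finset.mem_image.1 ha
  set U := Finset.univ.filter fun p : Fin n × Fin n =>
    p.1 < p.2 ∧ (undecided W τ G₀).Adj p.1 p.2 with hU
  have hUu : U.card ≤ u := by
    have h1 : 2 * U.card ≤ _ := two_mul_card_filter_lt_le (undecided W τ G₀)
    have h2 := hu G₀ hG₀
    omega
  calc _ ≤ (U.powerset ×ˢ ((Finset.univ : Finset (Finset (Fin n × Fin n))).filter
        fun s => s.card ≤ q)).card := by
        refine Finset.card_le_card_of_injOn
          (fun G => (U.filter fun p => G.1.Adj p.1 p.2, exceptional W τ G)) ?_ ?_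
        · intro G hG
          have hG := (Finset.mem_filter.1 hG).1
          exact Finset.mem_product.2 ⟨Finset.mem_powerset.2 (Finset.filter_subset _ _),
            Finset.mem_filter.2 ⟨Finset.mem_univ _, hq G hG⟩⟩
        · intro G hG H hH hGH
          have hG2 := (Finset.mem_filter.1 hG).2
          have hH2 := (Finset.mem_filter.1 hH).2
          simp only [Prod.mk.injEq, Finset.ext_iff, Prod.forall] at hGH
          obtain ⟨hGH1, hGH2⟩ := hGH
          have key : ∀ x y, x < y → (G.1.Adj x y ↔ H.1.Adj x y) := by
            intro x y hxy
            have e1 := hGH1 x y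
            have e2 := hGH2 x y
            simp only [hU, Finset.mem_filter, Finset.mem_univ, true_and, exceptional,
              undecided_congr hG2, undecided_congr hH2, adjProb_congr hG2,
              adjProb_congr hH2] at e1 e2
            have := hxy.ne
            tauto
          refine Subtype.ext (SimpleGraph.ext ?_)
          funext x y
          rcases lt_trichotomy x y with h | rfl | h
          · exact propext (key x y h)
          · simp
          · rw [SimpleGraph.adj_comm, H.1.adj_comm]
            exact propext (key y x h)
    _ = 2 ^ U.card * ((Finset.univ : Finset (Finset (Fin n × Fin n))).filter
        fun s => s.card ≤ q).card := by rw [Finset.card_product, Finset.card_powerset]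
    _ ≤ 2 ^ u * (n ^ 2 + 1) ^ q := by
        gcongr
        · norm_num
        · exact (card_filter_card_le q).trans (by simp [sq])

end Counting

section UpperBound

lemma card_le_four_mul {n : ℕ} [NeZero n] {P : ∀ n, Set (SimpleGraph (Fin n))}
    (hP : IsHereditary P) {r M : ℕ} (hr : 1 ≤ r)
    (hobs : ∀ col : Fin (r + 1) × Fin M → Fin (r + 1) × Fin M → Bool,
      (∀ x y, col x y = col y x) →
      ∃ (N : ℕ) (ψ : Fin N ↪ Fin (r + 1) × Fin M) (F : SimpleGraph (Fin N)), F ∉ P N ∧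
        ∀ u u', u ≠ u' → (ψ u).1 = (ψ u').1 → (F.Adj u u' ↔ col (ψ u) (ψ u') = true))
    {τ δ η : ℝ} (hτ0 : 0 < τ) (hτ1 : τ ≤ 1 / 2) (hδ : 0 < δ) (hη : 0 < η)
    (hn : 2 * (((r + 1) * M : ℕ) : ℝ) ^ 2 ≤ n * (δ ^ r) ^ (M ^ (r + 1)))
    (hηκ : 4 * (((r + 1) * M : ℕ) : ℝ) ^ 3 * η
      ≤ (δ ^ r) ^ (M ^ (r + 1)) * τ ^ (((r + 1) * M) ^ 2)) :
    ∃ w u q : ℕ, w * η ^ 2 ≤ 1 ∧ 2 * (u : ℝ) ≤ (1 - 1 / (r : ℝ) + δ) * (n : ℝ) ^ 2 ∧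
      (q : ℝ) ≤ 4 * τ * (n : ℝ) ^ 2 ∧
      Nat.card (P n) ≤ 4 * (2 ^ u * (n ^ 2 + 1) ^ q * 2 ^ (w * n)) := by
  classical
  have hn0 : (0 : ℝ) < n := by exact_mod_cast Nat.pos_of_ne_zero (NeZero.ne n)
  have hr1 : 1 / (r : ℝ) ≤ 1 := by
    rw [div_le_one (by exact_mod_cast hr)]; exact_mod_cast hr
  have hc0 : 0 ≤ (1 - 1 / (r : ℝ) + δ) * (n : ℝ) ^ 2 := by
    have : 0 ≤ 1 - 1 / (r : ℝ) + δ := by linarith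
    positivity
  rcases isEmpty_or_nonempty (P n) with hemp | hne
  · exact ⟨0, 0, 0, by simp, by simpa using hc0, by simp; positivity, by simp⟩
  rw [Nat.card_eq_fintype_card]
  obtain ⟨W, hWη, hW⟩ := exists_pinned_set (𝒜 := P n) hη
  have hA : (0 : ℝ) < Fintype.card (P n) := by exact_mod_cast Fintype.card_pos
  set k := (r + 1) * M with hk
  set κ := (δ ^ r) ^ (M ^ (r + 1)) with hκ
  have hκ0 : 0 < κ := by positivity
  set c := (1 - 1 / (r : ℝ) + δ) * (n : ℝ) ^ 2 with hc
  set bad : Finset (P n) := Finset.univ.filter fun G =>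
    c ≤ (cliqueTuples (undecided W τ G) 2).card with hbad
  set wild : Finset (P n) := Finset.univ.filter fun G =>
    4 * τ * (n : ℝ) ^ 2 < (exceptional W τ G).card with hwild
  have hbadcard : (bad.card : ℝ) ≤ Fintype.card (P n) / 2 := by
    have hinj : ∀ G ∈ bad, κ / 2 * (n : ℝ) ^ k
        ≤ ((multipartiteHoms (undecided W τ G) (r + 1) M).filter
          fun φ => Function.Injective φ).card := by
      intro G hG
      have hG' : (1 - 1 / (r : ℝ) + δ) * (Fintype.card (Fin n) : ℝ) ^ 2
          ≤ (cliqueTuples (undecided W τ G) 2).card := by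
        rw [Fintype.card_fin]; exact (Finset.mem_filter.1 hG).2
      have h1 := le_card_multipartiteHoms (undecided W τ G) hr hδ hG' M
      rw [Fintype.card_fin] at h1
      have h2 := card_filter_not_injective_le (n := n) (I := Fin (r + 1) × Fin M)
      have hI : Fintype.card (Fin (r + 1) × Fin M) = k := by simp [hk]
      rw [hI] at h2
      have h3 : (((Finset.univ : Finset (Fin (r + 1) × Fin M → Fin n)).filter
          fun φ => ¬ Function.Injective φ).card : ℝ) ≤ κ / 2 * (n : ℝ) ^ k := by
        refine le_of_mul_le_mul_right (h2.trans ?_) hn0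
        calc (k : ℝ) ^ 2 * (n : ℝ) ^ k = (2 * (k : ℝ) ^ 2) * ((n : ℝ) ^ k / 2) := by ring
          _ ≤ (n * κ) * ((n : ℝ) ^ k / 2) := by gcongr
          _ = _ := by ring
      have h4 := Finset.card_filter_add_card_filter_not
        (s := multipartiteHoms (undecided W τ G) (r + 1) M) (fun φ => Function.Injective φ)
      have h5 : ((multipartiteHoms (undecided W τ G) (r + 1) M).filter
          fun φ => ¬ Function.Injective φ).card
          ≤ ((Finset.univ : Finset (Fin (r + 1) × Fin M → Fin n)).filter
            fun φ => ¬ Function.Injective φ).card :=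
        Finset.card_le_card (Finset.filter_subset_filter _ (Finset.subset_univ _))
      have h4' : (((multipartiteHoms (undecided W τ G) (r + 1) M).filter
          fun φ => Function.Injective φ).card : ℝ)
          + ((multipartiteHoms (undecided W τ G) (r + 1) M).filter
          fun φ => ¬ Function.Injective φ).card
          = (multipartiteHoms (undecided W τ G) (r + 1) M).card := by exact_mod_cast h4
      have h5' : (((multipartiteHoms (undecided W τ G) (r + 1) M).filter
          fun φ => ¬ Function.Injective φ).card : ℝ)
          ≤ ((Finset.univ : Finset (Fin (r + 1) × Fin M → Fin n)).filter
            fun φ => ¬ Function.Injective φ).card := by exact_mod_cast h5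
      linarith
    have h := card_mul_le_of_multipartiteHoms hP hobs hη hW hτ0.le hτ1 bad hinj
    have hpos : 0 < κ * τ ^ (k ^ 2) * (n : ℝ) ^ k := by positivity
    refine le_of_mul_le_mul_right ?_ hpos
    calc (bad.card : ℝ) * (κ * τ ^ (k ^ 2) * (n : ℝ) ^ k)
        = 2 * (bad.card * (κ / 2 * (n : ℝ) ^ k * τ ^ (k ^ 2))) := by ring
      _ ≤ 2 * ((k : ℝ) ^ 3 * ((n : ℝ) ^ k * Fintype.card (P n) * η)) := by gcongr
      _ = Fintype.card (P n) / 2 * (4 * (k : ℝ) ^ 3 * η * (n : ℝ) ^ k) := by ring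
      _ ≤ Fintype.card (P n) / 2 * (κ * τ ^ (k ^ 2) * (n : ℝ) ^ k) := by gcongr
  have hwildcard : (wild.card : ℝ) ≤ Fintype.card (P n) / 4 := by
    have h := sum_card_exceptional_le (𝒜 := P n) W hτ0.le hτ1
    rw [Fintype.card_fin] at h
    have h2 : (wild.card : ℝ) * (4 * τ * (n : ℝ) ^ 2)
        ≤ ∑ G : P n, ((exceptional W τ G).card : ℝ) := by
      calc (wild.card : ℝ) * (4 * τ * (n : ℝ) ^ 2) = ∑ G ∈ wild, 4 * τ * (n : ℝ) ^ 2 := by simp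
        _ ≤ ∑ G ∈ wild, ((exceptional W τ G).card : ℝ) :=
          Finset.sum_le_sum fun G hG => (Finset.mem_filter.1 hG).2.le
        _ ≤ _ := Finset.sum_le_univ_sum_of_nonneg fun G => by positivity
    have hpos : 0 < 4 * τ * (n : ℝ) ^ 2 := by positivity
    refine le_of_mul_le_mul_right (h2.trans (h.trans (le_of_eq ?_))) hpos
    ring
  have hgood := card_le_of_undecided_of_exceptional (Finset.univ \ (bad ∪ wild)) W τ
    (u := ⌊c / 2⌋₊) (q := ⌊4 * τ * (n : ℝ) ^ 2⌋₊) (fun G hG => by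
      have hG : ¬ c ≤ (cliqueTuples (undecided W τ G) 2).card := fun h =>
        (Finset.mem_sdiff.1 hG).2 (Finset.mem_union_left _ (by simpa [hbad] using h))
      have h1 := Nat.lt_floor_add_one (c / 2)
      have : ((cliqueTuples (undecided W τ G) 2).card : ℝ) < 2 * (⌊c / 2⌋₊ + 1 : ℕ) := by
        push_cast
        linarith [not_le.1 hG]
      have : (cliqueTuples (undecided W τ G) 2).card < 2 * (⌊c / 2⌋₊ + 1) := by exact_mod_cast this
      omega) (fun G hG => by
      have hG : ¬ 4 * τ * (n : ℝ) ^ 2 < (exceptional W τ G).card := fun h =>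
        (Finset.mem_sdiff.1 hG).2 (Finset.mem_union_right _ (by simpa [hwild] using h))
      exact Nat.le_floor (not_lt.1 hG))
  refine ⟨W.card, ⌊c / 2⌋₊, ⌊4 * τ * (n : ℝ) ^ 2⌋₊, hWη, ?_, Nat.floor_le (by positivity), ?_⟩
  · have := Nat.floor_le (a := c / 2) (by positivity)
    linarith
  · have h1 : Fintype.card (P n) ≤ (Finset.univ \ (bad ∪ wild)).card + (bad.card + wild.card) := by
      have h2 := Finset.le_card_sdiff (bad ∪ wild) (Finset.univ : Finset (P n))
      have h3 := Finset.card_union_le bad wild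
      rw [Finset.card_univ] at h2
      omega
    have h1' : (Fintype.card (P n) : ℝ)
        ≤ (Finset.univ \ (bad ∪ wild)).card + (bad.card + wild.card) := by exact_mod_cast h1
    have h4 : (Fintype.card (P n) : ℝ) ≤ 4 * ((Finset.univ \ (bad ∪ wild)).card : ℝ) := by
      linarith
    have h5 : Fintype.card (P n) ≤ 4 * (Finset.univ \ (bad ∪ wild)).card := by exact_mod_cast h4
    omega

open Filter in
lemma exists_eventually_card_le {P : ∀ n, Set (SimpleGraph (Fin n))} (hP : IsHereditary P) {r : ℕ}
    (hr : 1 ≤ r) (hs : ¬ HContained P (r + 1)) :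
    ∃ ε : ℝ, 0 < ε ∧ ∀ᶠ n : ℕ in atTop, (Nat.card (P n) : ℝ) ≤
      (2 : ℝ) ^ ((1 - 1 / (r : ℝ)) * (n : ℝ) ^ 2 / 2 + (n : ℝ) ^ ((2 : ℝ) - ε)) := by
  obtain ⟨M, hM, hobs⟩ := exists_obstruction hs
  set k := (r + 1) * M with hk
  set m := r * M ^ (r + 1) with hm
  have hk1 : 1 ≤ k := Nat.mul_pos (by omega) hM
  set a : ℝ := 1 / (8 * ((k : ℝ) ^ 2 + m)) with ha
  have hkm : (1 : ℝ) ≤ (k : ℝ) ^ 2 + m := by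
    have : 1 ≤ k ^ 2 + m := by nlinarith
    exact_mod_cast this
  have ha0 : 0 < a := by positivity
  have ham : a * ((k : ℝ) ^ 2 + m) = 1 / 8 := by rw [ha]; field_simp
  have ha8 : a ≤ 1 / 8 := by rw [← ham]; exact le_mul_of_one_le_right ha0.le hkm
  refine ⟨a / 2, by positivity, ?_⟩
  have ev1 : ∀ᶠ n : ℕ in atTop, 4 * (k : ℝ) ^ 3 ≤ (n : ℝ) ^ (1 / 8 : ℝ) :=
    ((tendsto_rpow_atTop (by norm_num)).comp tendsto_natCast_atTop_atTop).eventually_ge_atTop _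
  have ev2 : ∀ᶠ n : ℕ in atTop, (2 : ℝ) ≤ (n : ℝ) ^ a :=
    ((tendsto_rpow_atTop ha0).comp tendsto_natCast_atTop_atTop).eventually_ge_atTop _
  have ev3 : ∀ᶠ n : ℕ in atTop, 4 + 4 * (3 * (Real.log n / Real.log 2)) ≤ (n : ℝ) ^ (a / 2) := by
    have h1 : (fun x : ℝ => 4 + 4 * (3 * (Real.log x / Real.log 2))) =o[atTop]
        fun x => x ^ (a / 2) := by
      refine Asymptotics.IsLittleO.add ?_ ?_
      · refine (Asymptotics.isLittleO_const_left.2 (Or.inr ?_))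
        exact tendsto_norm_atTop_atTop.comp (tendsto_rpow_atTop (by positivity))
      · have := (isLittleO_log_rpow_atTop (r := a / 2) (by positivity)).const_mul_left
          (12 / Real.log 2)
        refine this.congr_left fun x => by ring
    have h2 := (h1.comp_tendsto tendsto_natCast_atTop_atTop).bound (zero_lt_one)
    filter_upwards [h2] with n hn
    simp only [Function.comp_apply, one_mul, Real.norm_eq_abs] at hn
    rw [abs_of_nonneg (Real.rpow_nonneg (Nat.cast_nonneg n) _)] at hn
    exact (le_abs_self _).trans hn
  filter_upwards [ev1, ev2, ev3, eventually_ge_atTop 2] with n h1 h2 h3 hn2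
  have : NeZero n := ⟨by omega⟩
  have hn0 : (0 : ℝ) < n := by exact_mod_cast (by omega : 0 < n)
  have hn1 : (1 : ℝ) ≤ n := by exact_mod_cast (by omega : 1 ≤ n)
  set x : ℝ := (n : ℝ) with hx
  have hpow : ∀ j : ℕ, (x ^ (-a)) ^ j = x ^ (-a * j) := fun j => by
    rw [Real.rpow_mul hn0.le, Real.rpow_natCast]
  have hκ : ((x ^ (-a)) ^ r) ^ (M ^ (r + 1)) = x ^ (-a * m) := by
    rw [← pow_mul, hpow]
  have ham' : a * m ≤ 1 / 8 := by
    rw [← ham]; gcongr; nlinarith [sq_nonneg (k : ℝ)]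
  have hk1' : (1 : ℝ) ≤ k := by exact_mod_cast hk1
  obtain ⟨w, u, q, hw, hu, hq, hcard⟩ := card_le_four_mul (n := n) hP hr hobs
    (τ := x ^ (-a)) (δ := x ^ (-a)) (η := x ^ (-(1 / 4) : ℝ))
    (by positivity) (by
      rw [Real.rpow_neg hn0.le, one_div]
      exact inv_anti₀ (by norm_num) h2) (by positivity) (by positivity) (by
      rw [hκ]
      calc 2 * (k : ℝ) ^ 2 ≤ 4 * (k : ℝ) ^ 3 := by nlinarith [sq_nonneg (k : ℝ)]
        _ ≤ x ^ (1 / 8 : ℝ) := h1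
        _ ≤ x ^ (1 + -a * m) := Real.rpow_le_rpow_of_exponent_le hn1 (by linarith)
        _ = x * x ^ (-a * m) := by rw [Real.rpow_add hn0, Real.rpow_one]) (by
      rw [hκ, hpow, ← Real.rpow_add hn0]
      calc 4 * (k : ℝ) ^ 3 * x ^ (-(1 / 4) : ℝ) ≤ x ^ (1 / 8 : ℝ) * x ^ (-(1 / 4) : ℝ) := by gcongr
        _ = x ^ (-(1 / 8) : ℝ) := by rw [← Real.rpow_add hn0]; norm_num
        _ = _ := by
          rw [← hk, Nat.cast_pow]
          congr 1
          linarith)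
  have hw' : (w : ℝ) * x ≤ x ^ (2 - a) := by
    have e : (x ^ (-(1 / 4) : ℝ)) ^ 2 = x ^ (-(1 / 2) : ℝ) := by
      rw [← Real.rpow_natCast, ← Real.rpow_mul hn0.le]; norm_num
    rw [e] at hw
    calc (w : ℝ) * x = w * x ^ (-(1 / 2) : ℝ) * x ^ (3 / 2 : ℝ) := by
          rw [mul_assoc, ← Real.rpow_add hn0]; norm_num
      _ ≤ 1 * x ^ (3 / 2 : ℝ) := by gcongr
      _ = x ^ (3 / 2 : ℝ) := one_mul _
      _ ≤ _ := Real.rpow_le_rpow_of_exponent_le hn1 (by linarith)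
  have hxa : x ^ (-a) * x ^ 2 = x ^ (2 - a) := by
    rw [← Real.rpow_natCast x 2, ← Real.rpow_add hn0]; congr 1; push_cast; ring
  have hone : 1 ≤ x ^ (2 - a) := Real.one_le_rpow hn1 (by linarith)
  set l := Real.log x / Real.log 2 with hl
  have hlog2 : 0 < Real.log 2 := Real.log_pos (by norm_num)
  have hl0 : 0 ≤ l := div_nonneg (Real.log_nonneg hn1) hlog2.le
  have hbase : (x ^ 2 + 1 : ℝ) ≤ 2 ^ (3 * l) := by
    have e : (2 : ℝ) ^ l = x := by
      rw [Real.rpow_def_of_pos (by norm_num), hl, mul_div_cancel₀ _ hlog2.ne', Real.exp_log hn0]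
    rw [mul_comm, Real.rpow_mul (by norm_num), e]
    have hx2 : (2 : ℝ) ≤ x := by rw [hx]; exact_mod_cast hn2
    have : x ^ (3 : ℝ) = x ^ 3 := by norm_cast
    rw [this]
    nlinarith [sq_nonneg x]
  calc (Nat.card (P n) : ℝ) ≤ 4 * (2 ^ u * (x ^ 2 + 1) ^ q * 2 ^ (w * n)) := by
        rw [hx]; exact_mod_cast hcard
    _ ≤ 4 * (2 ^ u * (2 ^ (3 * l)) ^ q * 2 ^ (w * n)) := by gcongr
    _ = (2 : ℝ) ^ (2 + u + 3 * l * q + w * x) := by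
        rw [Real.rpow_add (by norm_num), Real.rpow_add (by norm_num), Real.rpow_add (by norm_num),
          Real.rpow_mul_natCast (by norm_num), Real.rpow_natCast, hx, ← Nat.cast_mul,
          Real.rpow_natCast]
        norm_num
        ring
    _ ≤ _ := by
        refine Real.rpow_le_rpow_of_exponent_le (by norm_num) ?_
        have hu' : (u : ℝ) ≤ (1 - 1 / (r : ℝ)) * x ^ 2 / 2 + x ^ (2 - a) / 2 := by
          have : (1 - 1 / (r : ℝ) + x ^ (-a)) * x ^ 2
            = (1 - 1 / (r : ℝ)) * x ^ 2 + x ^ (-a) * x ^ 2 := by ring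
          rw [this, hxa] at hu
          linarith
        have hq' : 3 * l * q ≤ 4 * (3 * l) * x ^ (2 - a) := by
          rw [mul_assoc 4, hxa] at hq
          calc 3 * l * q ≤ 3 * l * (4 * x ^ (2 - a)) := by gcongr
            _ = _ := by ring
        have hfin : (4 + 4 * (3 * l)) * x ^ (2 - a) ≤ x ^ (2 - a / 2) := by
          calc (4 + 4 * (3 * l)) * x ^ (2 - a) ≤ x ^ (a / 2) * x ^ (2 - a) := by gcongr
            _ = _ := by rw [← Real.rpow_add hn0]; congr 1; ring
        nlinarith

end UpperBound

section LowerBound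

variable {n r : ℕ}

/-- The pairs of vertices with different colours. -/
def crossing (f : Fin n → Fin r) : Finset (Fin n × Fin n) :=
  Finset.univ.filter fun p => p.1 < p.2 ∧ f p.1 ≠ f p.2

lemma sum_sum_ite_eq (f : Fin n → Fin r) :
    ∑ x, ∑ y, (if f x = f y then (1 : ℝ) else 0)
      = ∑ j, (∑ x, if f x = j then (1 : ℝ) else 0) ^ 2 := by
  simp_rw [sq, Finset.sum_mul_sum]
  rw [Finset.sum_comm]
  simp_rw [Finset.sum_comm (s := (Finset.univ : Finset (Fin r)))]
  rw [Finset.sum_comm]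
  refine Finset.sum_congr rfl fun x _ => Finset.sum_congr rfl fun y _ => ?_
  simp [eq_comm]

lemma le_two_mul_card_crossing (hr : 1 ≤ r) (f : Fin n → Fin r) {c : ℝ}
    (hc : ∀ j, |(∑ x, if f x = j then (1 : ℝ) else 0) - n / r| ≤ c) :
    (1 - 1 / (r : ℝ)) * (n : ℝ) ^ 2 - r * c ^ 2 ≤ 2 * (crossing f).card := by
  have hr0 : (0 : ℝ) < r := by exact_mod_cast hr
  have h1 : ∑ j : Fin r, ((∑ x, if f x = j then (1 : ℝ) else 0) - n / r) ^ 2 ≤ r * c ^ 2 := by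
    calc _ ≤ ∑ j : Fin r, c ^ 2 := by
          refine Finset.sum_le_sum fun j _ => ?_
          rw [← sq_abs]
          gcongr
          exact hc j
      _ = _ := by simp
  have h2 : ∑ j : Fin r, ((∑ x, if f x = j then (1 : ℝ) else 0) - n / r) ^ 2
      = ∑ j : Fin r, (∑ x, if f x = j then (1 : ℝ) else 0) ^ 2 - (n : ℝ) ^ 2 / r := by
    have e : ∑ j : Fin r, ∑ x, (if f x = j then (1 : ℝ) else 0) = n := by
      rw [Finset.sum_comm]; simp
    simp_rw [sub_sq]
    rw [Finset.sum_add_distrib, Finset.sum_sub_distrib, ← Finset.sum_mul, ← Finset.mul_sum, e]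
    simp only [Finset.sum_const, Finset.card_univ, Fintype.card_fin, nsmul_eq_mul]
    field_simp
    ring
  have h3 : (n : ℝ) ^ 2 ≤ ∑ x, ∑ y, (if f x = f y then (1 : ℝ) else 0)
      + 2 * (crossing f).card := by
    have hsub : (Finset.univ : Finset (Fin n × Fin n)) ⊆
        (Finset.univ.filter fun p : Fin n × Fin n => f p.1 = f p.2)
          ∪ (crossing f ∪ (crossing f).image Prod.swap) := by
      rintro ⟨x, y⟩ -
      simp only [crossing, Finset.mem_union, Finset.mem_filter, Finset.mem_univ, true_and,
        Finset.mem_image, Prod.exists, Prod.swap_prod_mk, Prod.mk.injEq]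
      by_cases hxy : f x = f y
      · exact Or.inl hxy
      · rcases lt_trichotomy x y with h | h | h
        · exact Or.inr (Or.inl ⟨h, hxy⟩)
        · exact absurd (congrArg f h) hxy
        · exact Or.inr (Or.inr ⟨y, x, ⟨h, Ne.symm hxy⟩, rfl, rfl⟩)
    have hcard : n ^ 2 ≤ (Finset.univ.filter fun p : Fin n × Fin n => f p.1 = f p.2).card
        + 2 * (crossing f).card := by
      have e1 := Finset.card_le_card hsub
      have e2 := Finset.card_union_le (Finset.univ.filter fun p : Fin n × Fin n => f p.1 = f p.2)
        (crossing f ∪ (crossing f).image Prod.swap)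
      have e3 := Finset.card_union_le (crossing f) ((crossing f).image Prod.swap)
      have e4 := Finset.card_image_le (s := crossing f) (f := Prod.swap)
      have e5 : (Finset.univ : Finset (Fin n × Fin n)).card = n ^ 2 := by simp [sq]
      omega
    have e : ∑ x, ∑ y, (if f x = f y then (1 : ℝ) else 0)
        = (Finset.univ.filter fun p : Fin n × Fin n => f p.1 = f p.2).card := by
      rw [← Fintype.sum_prod_type fun p : Fin n × Fin n => if f p.1 = f p.2 then (1 : ℝ) else 0,
        Finset.sum_boole]
    rw [e]
    exact_mod_cast hcard
  rw [sum_sum_ite_eq] at h3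
  have : (1 - 1 / (r : ℝ)) * (n : ℝ) ^ 2 = (n : ℝ) ^ 2 - (n : ℝ) ^ 2 / r := by ring
  linarith

open scoped Classical in
/-- The graphs in which the adjacency of two vertices of the same colour `j` is given by `v j`. -/
noncomputable def splitGraphs (v : Fin r → Bool) (f : Fin n → Fin r) :
    Finset (SimpleGraph (Fin n)) :=
  Finset.univ.filter fun G => ∀ x y, x ≠ y → f x = f y → (G.Adj x y ↔ v (f x) = true)

lemma two_pow_le_card_splitGraphs (v : Fin r → Bool) (f : Fin n → Fin r) :
    2 ^ (crossing f).card ≤ (splitGraphs v f).card := by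
  classical
  rw [← Finset.card_powerset]
  set g : Finset (Fin n × Fin n) → SimpleGraph (Fin n) := fun T => SimpleGraph.fromRel fun x y =>
    x < y ∧ if f x = f y then v (f x) = true else (x, y) ∈ T with hg
  have hadj : ∀ T x y, x < y →
      ((g T).Adj x y ↔ if f x = f y then v (f x) = true else (x, y) ∈ T) := by
    intro T x y hxy
    simp only [hg, SimpleGraph.fromRel_adj, hxy, hxy.not_gt, hxy.ne, true_and, false_and, or_false,
      ne_eq, not_false_eq_true]
  refine Finset.card_le_card_of_injOn g ?_ ?_
  · intro T _
    simp only [splitGraphs, Finset.coe_filter, Finset.mem_univ, true_and, Set.mem_ofPred_eq]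
    intro x y hxy hf
    rcases lt_or_gt_of_ne hxy with h | h
    · rw [hadj T x y h, if_pos hf]
    · rw [SimpleGraph.adj_comm, hadj T y x h, if_pos hf.symm, hf]
  · intro T hT T' hT' h
    have hT := Finset.mem_powerset.1 hT
    have hT' := Finset.mem_powerset.1 hT'
    have key : ∀ p ∈ crossing f, (p ∈ T ↔ p ∈ T') := by
      rintro ⟨x, y⟩ hp
      obtain ⟨hxy, hf⟩ := (Finset.mem_filter.1 hp).2
      have h1 := hadj T x y hxy
      have h2 := hadj T' x y hxy
      rw [if_neg hf] at h1 h2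
      rw [← h1, ← h2, h]
    ext p
    exact ⟨fun hp => (key p (hT hp)).1 hp, fun hp => (key p (hT' hp)).2 hp⟩

open scoped Classical in
lemma card_splitGraphs_inter_le (v : Fin r → Bool) (f f' : Fin n → Fin r) :
    (splitGraphs v f ∩ splitGraphs v f').card ≤ 2 ^ (crossing f ∩ crossing f').card := by
  rw [← Finset.card_powerset]
  refine Finset.card_le_card_of_injOn
    (fun G => (crossing f ∩ crossing f').filter fun p => G.Adj p.1 p.2) ?_ ?_
  · intro G _
    exact Finset.mem_powerset.2 (Finset.filter_subset _ _)
  · intro G hG H hH h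
    simp only [splitGraphs, Finset.coe_inter, Finset.coe_filter, Finset.mem_univ, true_and,
      Set.mem_inter_iff, Set.mem_ofPred_eq] at hG hH
    have key : ∀ x y, x < y → (G.Adj x y ↔ H.Adj x y) := by
      intro x y hxy
      by_cases h1 : f x = f y
      · rw [hG.1 x y hxy.ne h1, hH.1 x y hxy.ne h1]
      by_cases h2 : f' x = f' y
      · rw [hG.2 x y hxy.ne h2, hH.2 x y hxy.ne h2]
      have := Finset.ext_iff.1 h (x, y)
      simpa [crossing, hxy, h1, h2] using this
    refine SimpleGraph.ext ?_
    funext x y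
    rcases lt_trichotomy x y with h | rfl | h
    · exact propext (key x y h)
    · simp
    · rw [G.adj_comm, H.adj_comm]
      exact propext (key y x h)

lemma card_splitGraphs (v : Fin r → Bool) (f : Fin n → Fin r) :
    (splitGraphs v f).card = 2 ^ (crossing f).card := by
  refine le_antisymm ?_ (two_pow_le_card_splitGraphs v f)
  simpa using card_splitGraphs_inter_le v f f

lemma mul_two_pow_le_two_mul_card {P : ∀ n, Set (SimpleGraph (Fin n))} {v : Fin r → Bool}
    (hv : ∀ (n : ℕ) (G : SimpleGraph (Fin n)), InHClass r v G → G ∈ P n) {K e t : ℕ}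
    (f : Fin K → Fin n → Fin r) (he : ∀ i, e ≤ (crossing (f i)).card)
    (ht : ∀ i j, i ≠ j → t ≤ (crossing (f i) \ crossing (f j)).card) (hK : 2 * K ≤ 2 ^ t) :
    K * 2 ^ e ≤ 2 * Nat.card (P n) := by
  classical
  set D : Fin K → Finset (SimpleGraph (Fin n)) := fun i =>
    splitGraphs v (f i) \ (Finset.univ.erase i).biUnion fun j => splitGraphs v (f j) with hD
  have hDcard : ∀ i, 2 ^ e ≤ 2 * (D i).card := by
    intro i
    have h1 : ∀ j ∈ Finset.univ.erase i, (splitGraphs v (f i) ∩ splitGraphs v (f j)).card * 2 ^ t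
        ≤ 2 ^ (crossing (f i)).card := by
      intro j hj
      have hij : i ≠ j := (Finset.ne_of_mem_erase hj).symm
      calc _ ≤ 2 ^ (crossing (f i) ∩ crossing (f j)).card
            * 2 ^ (crossing (f i) \ crossing (f j)).card := by
            gcongr
            · exact card_splitGraphs_inter_le v _ _
            · norm_num
            · exact ht i j hij
        _ = _ := by rw [← pow_add, Finset.card_inter_add_card_sdiff]
    have h2 : ((splitGraphs v (f i)) ∩ (Finset.univ.erase i).biUnion
        fun j => splitGraphs v (f j)).card * 2 ^ t ≤ K * 2 ^ (crossing (f i)).card := by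
      rw [Finset.inter_biUnion]
      calc _ ≤ (∑ j ∈ Finset.univ.erase i,
            (splitGraphs v (f i) ∩ splitGraphs v (f j)).card) * 2 ^ t := by
            gcongr
            exact Finset.card_biUnion_le
        _ = ∑ j ∈ Finset.univ.erase i,
            (splitGraphs v (f i) ∩ splitGraphs v (f j)).card * 2 ^ t := Finset.sum_mul _ _ _
        _ ≤ ∑ j ∈ Finset.univ.erase i, 2 ^ (crossing (f i)).card := Finset.sum_le_sum h1
        _ ≤ _ := by
            rw [Finset.sum_const, smul_eq_mul]
            gcongr
            exact (Finset.card_le_univ _).trans (by simp)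
    have h3 := Finset.card_inter_add_card_sdiff (splitGraphs v (f i))
      ((Finset.univ.erase i).biUnion fun j => splitGraphs v (f j))
    rw [card_splitGraphs] at h3
    have h4 : 2 ^ e ≤ 2 ^ (crossing (f i)).card := Nat.pow_le_pow_right (by norm_num) (he i)
    have hK0 : 0 < K := i.pos
    have h5 : 2 * ((splitGraphs v (f i)) ∩ (Finset.univ.erase i).biUnion
        fun j => splitGraphs v (f j)).card ≤ 2 ^ (crossing (f i)).card := by
      refine le_of_mul_le_mul_left (a := K) ?_ hK0
      calc _ = ((splitGraphs v (f i)) ∩ (Finset.univ.erase i).biUnion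
            fun j => splitGraphs v (f j)).card * (2 * K) := by ring
        _ ≤ _ := (Nat.mul_le_mul_left _ hK).trans h2
    have h6 : (D i).card = ((splitGraphs v (f i)) \ (Finset.univ.erase i).biUnion
        fun j => splitGraphs v (f j)).card := rfl
    omega
  have hdisj : ∀ i j, i ≠ j → Disjoint (D i) (D j) := by
    intro i j hij
    refine Finset.disjoint_left.2 fun G hi hj => (Finset.mem_sdiff.1 hi).2 ?_
    exact Finset.mem_biUnion.2 ⟨j, by simp [hij.symm], (Finset.mem_sdiff.1 hj).1⟩
  have hsub : (Finset.univ.biUnion D).card ≤ Nat.card (P n) := by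
    rw [Nat.card_eq_fintype_card, ← Set.toFinset_card]
    refine Finset.card_le_card fun G hG => ?_
    obtain ⟨i, -, hi⟩ := Finset.mem_biUnion.1 hG
    exact Set.mem_toFinset.2
      (hv n G ⟨f i, (Finset.mem_filter.1 (Finset.mem_sdiff.1 hi).1).2⟩)
  rw [Finset.card_biUnion fun i _ j _ hij => hdisj i j hij] at hsub
  calc K * 2 ^ e = ∑ i : Fin K, 2 ^ e := by simp
    _ ≤ ∑ i : Fin K, 2 * (D i).card := Finset.sum_le_sum fun i _ => hDcard i
    _ = 2 * ∑ i : Fin K, (D i).card := (Finset.mul_sum _ _ _).symm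
    _ ≤ _ := by gcongr

/-- The colouring of `Fin n` by residues modulo `r`. -/
def residueColouring (n : ℕ) (hr : 0 < r) (i : Fin n) : Fin r := ⟨i % r, Nat.mod_lt _ hr⟩

lemma card_residueColouring_eq (hr : 0 < r) (j : Fin r) :
    (Finset.univ.filter fun x => residueColouring n hr x = j).card
      = n / r + if (j : ℕ) < n % r then 1 else 0 := by
  have h := Nat.count_modEq_card n hr j
  rw [Nat.mod_eq_of_lt j.2] at h
  rw [← h, Nat.count_eq_card_filter_range, Finset.card_filter, Finset.card_filter,
    ← Fin.sum_univ_eq_sum_range (fun i => if i ≡ j [MOD r] then 1 else 0)]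
  refine Finset.sum_congr rfl fun x _ => ?_
  simp [residueColouring, Fin.ext_iff, Nat.ModEq, Nat.mod_eq_of_lt j.2]

lemma abs_sum_residueColouring_sub_le (hr : 0 < r) (j : Fin r) :
    |(∑ x, if residueColouring n hr x = j then (1 : ℝ) else 0) - n / r| ≤ 1 := by
  have hr0 : (0 : ℝ) < r := by exact_mod_cast hr
  rw [Finset.sum_boole, card_residueColouring_eq]
  have h1 : ((n / r : ℕ) : ℝ) ≤ n / r := Nat.cast_div_le
  have h2 : (n : ℝ) / r < (n / r : ℕ) + 1 := by
    rw [div_lt_iff₀ hr0]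
    have := Nat.lt_mul_div_succ n hr
    rw [mul_comm]
    exact_mod_cast this
  have h3 : ((n / r : ℕ) : ℝ) + 1 ≤ n / r + 1 := by linarith
  rw [abs_le]
  push_cast
  split_ifs <;> constructor <;> linarith

lemma abs_sum_update_sub_le (f : Fin n → Fin r) (a : Fin n) (b j : Fin r) :
    |(∑ x, if Function.update f a b x = j then (1 : ℝ) else 0)
      - ∑ x, if f x = j then (1 : ℝ) else 0| ≤ 1 := by
  rw [← Finset.sum_sub_distrib, Finset.sum_eq_single a]
  · split_ifs <;> simp
  · intro x _ hx
    simp [Function.update_of_ne hx]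
  · simp

lemma card_le_card_crossing_update_sdiff (f : Fin n → Fin r) {a a' : Fin n} {b : Fin r}
    (haa : a ≠ a') (ha' : f a' ≠ b) :
    (Finset.univ.filter fun x => f x = b).card
      ≤ (crossing (Function.update f a b) \ crossing (Function.update f a' b)).card := by
  refine Finset.card_le_card_of_injOn (fun z => (min a' z, max a' z)) ?_ ?_
  · intro z hz
    have hz : f z = b := by simpa using hz
    have hza : z ≠ a' := fun h => ha' (h ▸ hz)
    have e1 : Function.update f a b z = b := by
      by_cases h : z = a
      · simp [h]
      · simp [Function.update_of_ne h, hz]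
    have e2 : Function.update f a' b z = b := by simp [Function.update_of_ne hza, hz]
    have e3 : Function.update f a b a' = f a' := Function.update_of_ne haa.symm _ _
    rcases lt_or_gt_of_ne hza with h | h
    · simp [crossing, min_eq_right h.le, max_eq_left h.le, e1, e2, e3, ha'.symm, h]
    · simp [crossing, min_eq_left h.le, max_eq_right h.le, e1, e2, e3, ha', h]
  · intro z _ z' _ h
    simp only [Prod.mk.injEq] at h
    have h1 := h.1
    have h2 := h.2
    rcases le_total a' z with h3 | h3 <;> rcases le_total a' z' with h4 | h4 <;>
      simp only [h3, h4, min_eq_left, min_eq_right, max_eq_left, max_eq_right] at h1 h2 <;> simp_all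

open Filter in
/-- If `𝒫` contains some `ℋ(r, v)`, it eventually has at least `2 ^ ((1 - 1/r) n² / 2)` members
on `n` vertices. The balanced partition alone falls short of this by a bounded factor, so the
graphs split by several nearby partitions are counted together. -/
lemma eventually_le_card {P : ∀ n, Set (SimpleGraph (Fin n))} (hr : 1 ≤ r)
    (hP : HContained P r) :
    ∀ᶠ n : ℕ in atTop,
      (2 : ℝ) ^ ((1 - 1 / (r : ℝ)) * (n : ℝ) ^ 2 / 2) ≤ (Nat.card (P n) : ℝ) := by
  classical
  obtain ⟨v, hv⟩ := hP
  rcases hr.eq_or_lt with rfl | hr2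
  · refine Eventually.of_forall fun n => ?_
    have hpos : 0 < Nat.card (P n) := by
      obtain ⟨G, hG⟩ : (splitGraphs v fun _ : Fin n => (0 : Fin 1)).Nonempty :=
        Finset.card_pos.1 ((pow_pos two_pos _).trans_le (two_pow_le_card_splitGraphs v _))
      have : Nonempty (P n) := ⟨G, hv n G ⟨_, (Finset.mem_filter.1 hG).2⟩⟩
      exact Nat.card_pos
    have : (1 : ℝ) ≤ Nat.card (P n) := by exact_mod_cast hpos
    simpa using this
  set K := 2 ^ (2 * r + 1) with hK
  filter_upwards [eventually_ge_atTop (r * (K + (2 * r + 2)))] with n hn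
  have hKn : ∀ t : Fin K, r * t < n := by
    intro t
    have : r * t < r * K := Nat.mul_lt_mul_of_pos_left t.2 hr
    nlinarith
  have hr0 : (0 : ℝ) < r := by exact_mod_cast hr
  let a : Fin K → Fin n := fun t => ⟨r * t, hKn t⟩
  let f := residueColouring n hr
  let b : Fin r := ⟨1, hr2⟩
  let e := ⌈((1 - 1 / (r : ℝ)) * (n : ℝ) ^ 2 - r * 2 ^ 2) / 2⌉₊
  have hcount : K * 2 ^ e ≤ 2 * Nat.card (P n) := by
    refine mul_two_pow_le_two_mul_card hv (t := 2 * r + 2) (fun t => Function.update f (a t) b)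
      (fun t => Nat.ceil_le.2 ?_) (fun t t' htt => ?_) (by rw [hK]; ring_nf; rfl)
    · have := le_two_mul_card_crossing hr (Function.update f (a t) b) (c := 2) fun j => by
        have h1 := abs_sum_update_sub_le f (a t) b j
        have h2 := abs_sum_residueColouring_sub_le (n := n) hr j
        rw [abs_le] at *
        constructor <;> linarith
      linarith
    · refine le_trans ?_ (card_le_card_crossing_update_sdiff f (a := a t) (a' := a t') ?_ ?_)
      · rw [card_residueColouring_eq]
        refine le_trans ?_ (Nat.le_add_right _ _)
        rw [Nat.le_div_iff_mul_le hr]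
        nlinarith
      · intro h
        have := Fin.ext_iff.1 h
        exact htt (Fin.ext (Nat.eq_of_mul_eq_mul_left hr this))
      · simp [f, a, b, residueColouring, Fin.ext_iff]
  have hcard : 2 ^ (2 * r + e) ≤ Nat.card (P n) := by
    have : K * 2 ^ e = 2 * 2 ^ (2 * r + e) := by rw [hK]; ring
    omega
  calc (2 : ℝ) ^ ((1 - 1 / (r : ℝ)) * (n : ℝ) ^ 2 / 2)
      ≤ (2 : ℝ) ^ ((2 * r + e : ℕ) : ℝ) := by
        refine Real.rpow_le_rpow_of_exponent_le one_le_two ?_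
        have : ((1 - 1 / (r : ℝ)) * (n : ℝ) ^ 2 - r * 2 ^ 2) / 2 ≤ e := Nat.le_ceil _
        push_cast
        linarith
    _ ≤ _ := by
        rw [Real.rpow_natCast]
        exact_mod_cast hcard

end LowerBound

/-- **Theorem (speed of a hereditary property).**  Let `𝒫` be a hereditary property of
graphs with `χ_c(𝒫) = r ≥ 1`.  Then there exists `ε = ε(𝒫) > 0` such that
`2 ^ ((1 - 1/r) n² / 2) ≤ |𝒫_n| ≤ 2 ^ ((1 - 1/r) n² / 2 + n ^ (2 - ε))`
for every sufficiently large `n`. -/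
theorem speed_of_hereditary (r : ℕ) (hr : 1 ≤ r)
    (P : ∀ n, Set (SimpleGraph (Fin n)))
    (hP : IsHereditary P) (hcol : ColNumEq P r) :
    ∃ ε : ℝ, 0 < ε ∧ ∃ N : ℕ, ∀ n : ℕ, N ≤ n →
      (2 : ℝ) ^ ((1 - 1 / (r : ℝ)) * (n : ℝ) ^ 2 / 2) ≤ (Nat.card (P n) : ℝ) ∧
      (Nat.card (P n) : ℝ) ≤
        (2 : ℝ) ^ ((1 - 1 / (r : ℝ)) * (n : ℝ) ^ 2 / 2 + (n : ℝ) ^ ((2 : ℝ) - ε)) := by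
  obtain ⟨ε, hε, hupper⟩ := exists_eventually_card_le hP hr fun h =>
    absurd (hcol.2 _ h) (Nat.not_succ_le_self r)
  obtain ⟨N, hN⟩ := Filter.eventually_atTop.1 ((eventually_le_card hr hcol.1).and hupper)
  exact ⟨ε, hε, N, hN⟩

end ABBM
end

section
/- Let r, m ∈ ℕ, and for each v ∈ {0,1}^r let H_v ∈ ℋ(r,v) be a graph with at most m vertices. If k = k(r,m) ∈ ℕ is sufficiently large, then for every graph G, either G is U(r,k)-free, or G contains an induced copy of H_v for some v ∈ {0,1}^r. -/
open scoped symmDiff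

namespace ABBM

variable {V : Type*}

/-- `uSizeAux k j = (a, s)` where `a` is the size of the `(j+1)`-st part of the generalized
universal graph `U(r,k)` and `s` is the total size of its first `j+1` parts:
the first part has size `k` and each subsequent part has size `2` to the power of the sum
of the sizes of all previous parts. -/
def uSizeAux (k : ℕ) : ℕ → ℕ × ℕ
  | 0 => (k, k)
  | j + 1 => (2 ^ (uSizeAux k j).2, (uSizeAux k j).2 + 2 ^ (uSizeAux k j).2)

/-- The size of the `(j+1)`-st part of `U(r,k)`. -/
def uSize (k j : ℕ) : ℕ := (uSizeAux k j).1

/-- The total number of vertices `|U(r,k)|`. -/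
def uTotal (r k : ℕ) : ℕ := ∑ j ∈ Finset.range r, uSize k j

/-- The `r`-partite graph induced by `G` between the (disjoint) parts `A 0, …, A (r-1)`
is the generalized universal graph `U(r,k)`: the parts have the prescribed sizes and each
part shatters the union of all previous parts. -/
def IsUParts [DecidableEq V] (G : SimpleGraph V) (r k : ℕ) (A : Fin r → Finset V) : Prop :=
  (∀ i j : Fin r, i ≠ j → Disjoint (A i) (A j)) ∧
  (∀ j : Fin r, (A j).card = uSize k j.val) ∧
  (∀ j : Fin r, j.val ≠ 0 →
    Shatters G (A j) ((Finset.univ.filter fun i => i < j).biUnion A))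

/-- The parts `A` induce a copy of `U*_v(r,k)` in `G`: between distinct parts the graph is
`U(r,k)`, and part `j` induces a complete graph if `v j = true` and an empty graph otherwise. -/
def IsUStarParts [DecidableEq V] (G : SimpleGraph V) (r k : ℕ) (v : Fin r → Bool)
    (A : Fin r → Finset V) : Prop :=
  IsUParts G r k A ∧
  ∀ j : Fin r, ∀ x ∈ A j, ∀ y ∈ A j, x ≠ y → (G.Adj x y ↔ v j = true)

/-- Ramsey's theorem for graphs, inside a finite vertex set. -/
theorem exists_clique_or_indep (a b : ℕ) :
    ∃ L : ℕ, ∀ (X : Type) (G : SimpleGraph X) (S : Finset X), L ≤ S.card →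
      (∃ T ⊆ S, T.card = a ∧ ∀ x ∈ T, ∀ y ∈ T, x ≠ y → G.Adj x y) ∨
      (∃ T ⊆ S, T.card = b ∧ ∀ x ∈ T, ∀ y ∈ T, x ≠ y → ¬ G.Adj x y) := by
  classical
  induction a generalizing b with
  | zero => exact ⟨0, fun X G S _ => Or.inl ⟨∅, by simp⟩⟩
  | succ a iha =>
    induction b with
    | zero => exact ⟨0, fun X G S _ => Or.inr ⟨∅, by simp⟩⟩
    | succ b ihb =>
      obtain ⟨L₁, h₁⟩ := iha (b + 1)
      obtain ⟨L₂, h₂⟩ := ihb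
      refine ⟨L₁ + L₂ + 1, fun X G S hS => ?_⟩
      obtain ⟨z, hz⟩ : S.Nonempty := Finset.card_pos.mp (by omega)
      have hcard := Finset.card_filter_add_card_filter_not (s := S.erase z) (fun y => G.Adj z y)
      rw [Finset.card_erase_of_mem hz] at hcard
      have hsub (q : X → Prop) [DecidablePred q] : (S.erase z).filter q ⊆ S :=
        (Finset.filter_subset _ _).trans (Finset.erase_subset _ _)
      rcases le_or_gt L₁ ((S.erase z).filter fun y => G.Adj z y).card with hL | hL
      · rcases h₁ X G _ hL with ⟨T, hT, hc, hadj⟩ | ⟨T, hT, hc, hadj⟩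
        · have hzT : z ∉ T := fun h => by simpa using hT h
          have hzadj : ∀ y ∈ T, G.Adj z y := fun y hy => (Finset.mem_filter.mp (hT hy)).2
          refine Or.inl ⟨insert z T, Finset.insert_subset hz (hT.trans (hsub _)), ?_, ?_⟩
          · rw [Finset.card_insert_of_notMem hzT, hc]
          · intro x hx y hy hxy
            rcases Finset.mem_insert.mp hx with rfl | hx' <;>
              rcases Finset.mem_insert.mp hy with rfl | hy'
            · exact absurd rfl hxy
            · exact hzadj y hy'
            · exact (hzadj x hx').symm
            · exact hadj x hx' y hy' hxy
        · exact Or.inr ⟨T, hT.trans (hsub _), hc, hadj⟩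
      · rcases h₂ X G ((S.erase z).filter fun y => ¬ G.Adj z y) (by omega) with
          ⟨T, hT, hc, hadj⟩ | ⟨T, hT, hc, hadj⟩
        · exact Or.inl ⟨T, hT.trans (hsub _), hc, hadj⟩
        · have hzT : z ∉ T := fun h => by simpa using hT h
          have hzadj : ∀ y ∈ T, ¬ G.Adj z y := fun y hy => (Finset.mem_filter.mp (hT hy)).2
          refine Or.inr ⟨insert z T, Finset.insert_subset hz (hT.trans (hsub _)), ?_, ?_⟩
          · rw [Finset.card_insert_of_notMem hzT, hc]
          · intro x hx y hy hxy
            rcases Finset.mem_insert.mp hx with rfl | hx' <;>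
              rcases Finset.mem_insert.mp hy with rfl | hy'
            · exact absurd rfl hxy
            · exact hzadj y hy'
            · exact fun h => hzadj x hx' h.symm
            · exact hadj x hx' y hy' hxy

/-- Ramsey's theorem: every graph on sufficiently many vertices has a homogeneous set that is
a copy of the given finite type `W`. -/
theorem exists_homogeneous_embedding (W : Type) [Finite W] :
    ∃ L : ℕ, ∀ G : SimpleGraph (Fin L), ∃ (τ : W ↪ Fin L) (b : Bool),
      ∀ x y : W, x ≠ y → (G.Adj (τ x) (τ y) ↔ b = true) := by
  classical
  obtain ⟨L, hL⟩ := exists_clique_or_indep (Nat.card W) (Nat.card W)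
  have key (T : Finset (Fin L)) (hT : T.card = Nat.card W) : ∃ τ : W ↪ Fin L, ∀ x, τ x ∈ T := by
    have e : W ≃ T := (Finite.equivFinOfCardEq hT.symm).trans T.equivFin.symm
    exact ⟨e.toEmbedding.trans (Function.Embedding.subtype _), fun x => (e x).2⟩
  refine ⟨L, fun G => ?_⟩
  rcases hL (Fin L) G Finset.univ (by simp) with ⟨T, -, hc, hadj⟩ | ⟨T, -, hc, hadj⟩ <;>
    obtain ⟨τ, hτ⟩ := key T hc
  · exact ⟨τ, true, fun x y hxy =>
      iff_of_true (hadj _ (hτ x) _ (hτ y) (τ.injective.ne hxy)) rfl⟩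
  · exact ⟨τ, false, fun x y hxy =>
      iff_of_false (hadj _ (hτ x) _ (hτ y) (τ.injective.ne hxy)) Bool.false_ne_true⟩

/-- The `j`-partite graph induced by `G` on `B 0, …, B (j-1)` is universal for `W`: it contains
every `j`-partite graph on `W`, with any prescribed partition `p`. -/
def IsUniversal (G : SimpleGraph V) (W : Type) (j : ℕ) (B : ℕ → Finset V) : Prop :=
  ∀ p : W → ℕ, (∀ w, p w < j) → ∀ Q : SimpleGraph W, ∃ f : W ↪ V,
    (∀ w, f w ∈ B (p w)) ∧ ∀ x y, p x ≠ p y → (G.Adj (f x) (f y) ↔ Q.Adj x y)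

/-- If `A` shatters a set containing parts which are universal for a sufficiently large type, then
`A` contains distinct vertices `t i` such that every partite graph on `W` can be found in the parts
with prescribed adjacencies to all the `t i`. -/
theorem exists_universal_transversal {G : SimpleGraph V} {W Λ : Type} [Nonempty W] {j : ℕ}
    (hj : j ≠ 0) {B : ℕ → Finset V} {A U : Finset V} (hB : ∀ i < j, B i ⊆ U)
    (hU : IsUniversal G (((W → Fin j) × SimpleGraph W × (W → Set Λ)) × W) j B)
    (hA : Shatters G A U) :
    ∃ t : Λ → V, Function.Injective t ∧ (∀ i, t i ∈ A) ∧
      ∀ (p : W → ℕ) (Q : SimpleGraph W) (D : W → Set Λ), ∃ f : W → V, Function.Injective f ∧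
        (∀ w, p w < j → f w ∈ B (p w)) ∧
        (∀ x y, p x < j → p y < j → p x ≠ p y → (G.Adj (f x) (f y) ↔ Q.Adj x y)) ∧
        ∀ x i, G.Adj (t i) (f x) ↔ i ∈ D x := by
  classical
  have hj' : 0 < j := Nat.pos_of_ne_zero hj
  let R : SimpleGraph (((W → Fin j) × SimpleGraph W × (W → Set Λ)) × W) :=
    { Adj := fun u w => u.1 = w.1 ∧ u.1.2.1.Adj u.2 w.2
      symm := ⟨fun u w h => ⟨h.1.symm, by rw [← h.1]; exact h.2.symm⟩⟩
      loopless := ⟨fun u h => h.2.ne rfl⟩ }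
  obtain ⟨F, hF, hadj⟩ := hU (fun u => u.1.1 u.2) (fun u => (u.1.1 u.2).2) R
  have hFU : ∀ u, F u ∈ U := fun u => hB _ (u.1.1 u.2).2 (hF u)
  choose t htA ht using fun i : Λ =>
    hA (U.filter fun z => ∃ u, F u = z ∧ i ∈ u.1.2.2 u.2) (Finset.filter_subset _ _)
  have htF : ∀ i u, G.Adj (t i) (F u) ↔ i ∈ u.1.2.2 u.2 := by
    intro i u
    rw [ht i _ (hFU u), Finset.mem_filter]
    constructor
    · rintro ⟨-, w, hw, hi⟩
      rwa [F.injective hw] at hi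
    · exact fun h => ⟨hFU u, u, rfl, h⟩
  refine ⟨t, fun i i' h => ?_, htA, fun p Q D => ?_⟩
  · obtain ⟨w⟩ := ‹Nonempty W›
    have h₁ := htF i ((fun _ => ⟨0, hj'⟩, ⊥, fun _ => {i}), w)
    rw [h, htF] at h₁
    exact (h₁.mpr rfl).symm
  · let c : (W → Fin j) × SimpleGraph W × (W → Set Λ) :=
      (fun w => if h : p w < j then ⟨p w, h⟩ else ⟨0, hj'⟩, Q, D)
    have hc : ∀ w, p w < j → ((c.1 w : Fin j) : ℕ) = p w := fun w h => by simp [c, h]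
    refine ⟨fun w => F (c, w), fun x y h => (Prod.ext_iff.mp (F.injective h)).2,
      fun w h => ?_, fun x y hx hy hxy => ?_, fun x i => htF i (c, x)⟩
    · have := hF (c, w)
      rwa [hc w h] at this
    · rw [hadj (c, x) (c, y) (by simpa only [hc x hx, hc y hy] using hxy)]
      exact and_iff_right rfl

/-- Adding to `j` parts a further part consisting of vertices `s w`, over which every adjacency
to the first `j` parts can be prescribed, keeps the parts universal. -/
theorem isUniversal_update {G : SimpleGraph V} {W : Type} {j : ℕ} {B : ℕ → Finset V}
    {C : Finset V} (hdisj : ∀ i < j, Disjoint (B i) C) {s : W → V}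
    (hs : Function.Injective s) (hsC : ∀ w, s w ∈ C)
    (h : ∀ (p : W → ℕ) (Q : SimpleGraph W), ∃ f : W → V,
      (∀ x y, p x < j → p y < j → f x = f y → x = y) ∧
      (∀ w, p w < j → f w ∈ B (p w)) ∧
      (∀ x y, p x < j → p y < j → p x ≠ p y → (G.Adj (f x) (f y) ↔ Q.Adj x y)) ∧
      ∀ x y, p x < j → (G.Adj (s y) (f x) ↔ Q.Adj y x)) :
    IsUniversal G W (j + 1) (Function.update B j C) := by
  classical
  intro p hp Q
  obtain ⟨f, hinj, hfB, hadj, hadj'⟩ := h p Q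
  have hne : ∀ x y, p x < j → f x ≠ s y := fun x y hx he =>
    Finset.disjoint_left.mp (hdisj _ hx) (hfB x hx) (he ▸ hsC y)
  have htop : ∀ x, ¬ p x < j → p x = j := fun x hx => by have := hp x; omega
  let g : W → V := fun w => if p w < j then f w else s w
  have hlow : ∀ x, p x < j → g x = f x := fun x hx => if_pos hx
  have hup : ∀ x, ¬ p x < j → g x = s x := fun x hx => if_neg hx
  refine ⟨⟨g, fun x y hxy => ?_⟩, fun w => ?_, fun x y hxy => ?_⟩
  · by_cases hx : p x < j <;> by_cases hy : p y < j
    · rw [hlow x hx, hlow y hy] at hxy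
      exact hinj x y hx hy hxy
    · rw [hlow x hx, hup y hy] at hxy
      exact absurd hxy (hne x y hx)
    · rw [hup x hx, hlow y hy] at hxy
      exact absurd hxy.symm (hne y x hy)
    · rw [hup x hx, hup y hy] at hxy
      exact hs hxy
  · change g w ∈ _
    by_cases hw : p w < j
    · rw [hlow w hw, Function.update_of_ne hw.ne]
      exact hfB w hw
    · rw [hup w hw, htop w hw, Function.update_self]
      exact hsC w
  · change G.Adj (g x) (g y) ↔ _
    by_cases hx : p x < j <;> by_cases hy : p y < j
    · rw [hlow x hx, hlow y hy]
      exact hadj x y hx hy hxy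
    · rw [hlow x hx, hup y hy, G.adj_comm, hadj' x y hx, Q.adj_comm]
    · rw [hup x hx, hlow y hy]
      exact hadj' y x hy
    · exact absurd ((htop x hx).trans (htop y hy).symm) hxy

/-- If each of the disjoint sets `A 0, …, A (j-1)` shatters the union of the previous ones and
`A 0` is large, then they contain homogeneous subsets which are universal for `W`. -/
theorem exists_homogeneous_universal (j : ℕ) (W : Type) [Finite W] [Nonempty W] :
    ∃ k₀ : ℕ, ∀ (V : Type) [DecidableEq V] (G : SimpleGraph V) (A : ℕ → Finset V),
      (∀ i < j, ∀ i' < j, i ≠ i' → Disjoint (A i) (A i')) → k₀ ≤ (A 0).card →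
      (∀ i < j, i ≠ 0 → Shatters G (A i) ((Finset.range i).biUnion A)) →
      ∃ (v : ℕ → Bool) (B : ℕ → Finset V), (∀ i < j, B i ⊆ A i) ∧
        (∀ i < j, ∀ x ∈ B i, ∀ y ∈ B i, x ≠ y → (G.Adj x y ↔ v i = true)) ∧
        IsUniversal G W j B := by
  induction j generalizing W with
  | zero =>
    refine ⟨0, fun V _ G A _ _ _ => ⟨fun _ => true, A, by simp, by simp, fun p hp => ?_⟩⟩
    obtain ⟨w⟩ := ‹Nonempty W›
    exact absurd (hp w) (Nat.not_lt_zero _)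
  | succ j ih =>
    cases nonempty_fintype W
    obtain ⟨L, hL⟩ := exists_homogeneous_embedding W
    obtain ⟨k₁, hk₁⟩ : ∃ k₁ : ℕ, ∀ (V : Type) [DecidableEq V] (G : SimpleGraph V)
        (A : ℕ → Finset V),
        (∀ i < j + 1, ∀ i' < j + 1, i ≠ i' → Disjoint (A i) (A i')) → k₁ ≤ (A 0).card →
        (∀ i < j + 1, i ≠ 0 → Shatters G (A i) ((Finset.range i).biUnion A)) →
        ∃ (v : ℕ → Bool) (B : ℕ → Finset V), (∀ i < j, B i ⊆ A i) ∧
          (∀ i < j, ∀ x ∈ B i, ∀ y ∈ B i, x ≠ y → (G.Adj x y ↔ v i = true)) ∧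
          ∃ t : Fin L → V, Function.Injective t ∧ (∀ i, t i ∈ A j) ∧
            ∀ (p : W → ℕ) (Q : SimpleGraph W) (D : W → Set (Fin L)), ∃ f : W → V,
              (∀ x y, p x < j → p y < j → f x = f y → x = y) ∧
              (∀ w, p w < j → f w ∈ B (p w)) ∧
              (∀ x y, p x < j → p y < j → p x ≠ p y → (G.Adj (f x) (f y) ↔ Q.Adj x y)) ∧
              ∀ x i, p x < j → (G.Adj (t i) (f x) ↔ i ∈ D x) := by
      rcases eq_or_ne j 0 with rfl | hj
      · refine ⟨L + 1, fun V _ G A _ hk _ => ⟨fun _ => true, A, by simp, by simp, ?_⟩⟩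
        obtain ⟨a, -⟩ : (A 0).Nonempty := Finset.card_pos.mp (by omega)
        refine ⟨fun i => (A 0).equivFin.symm (Fin.castLE (by omega) i), ?_, fun i => Finset.coe_mem _,
          fun p Q D => ⟨fun _ => a, by simp⟩⟩
        exact Subtype.val_injective.comp
          ((Equiv.injective _).comp (Fin.castLE_injective _))
      · have : Nonempty (Fin j) := ⟨⟨0, Nat.pos_of_ne_zero hj⟩⟩
        obtain ⟨k₁, hk₁⟩ := ih (((W → Fin j) × SimpleGraph W × (W → Set (Fin L))) × W)
        refine ⟨k₁, fun V _ G A hdisj hk hsh => ?_⟩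
        obtain ⟨v, B, hBA, hom, hU⟩ := hk₁ V G A
          (fun i hi i' hi' => hdisj i (by omega) i' (by omega)) hk
          (fun i hi => hsh i (by omega))
        obtain ⟨t, ht, htA, H⟩ := exists_universal_transversal hj
          (fun i hi => (hBA i hi).trans
            (Finset.subset_biUnion_of_mem A (Finset.mem_range.mpr hi))) hU (hsh j (by omega) hj)
        refine ⟨v, B, hBA, hom, t, ht, htA, fun p Q D => ?_⟩
        obtain ⟨f, h₁, h₂, h₃, h₄⟩ := H p Q D
        exact ⟨f, fun x y _ _ h => h₁ h, h₂, h₃, fun x i _ => h₄ x i⟩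
    refine ⟨k₁, fun V _ G A hdisj hk hsh => ?_⟩
    obtain ⟨v, B, hBA, hom, t, ht, htA, H⟩ := hk₁ V G A hdisj hk hsh
    obtain ⟨τ, b, hτ⟩ := hL (G.comap t)
    let C : Finset V := Finset.univ.image fun w => t (τ w)
    have hCA : C ⊆ A j := Finset.image_subset_iff.mpr fun w _ => htA _
    refine ⟨Function.update v j b, Function.update B j C, fun i hi => ?_, fun i hi => ?_,
      isUniversal_update (s := fun w => t (τ w)) (fun i hi => ?_) (ht.comp τ.injective)
        (fun w => Finset.mem_image_of_mem _ (Finset.mem_univ w)) (fun p Q => ?_)⟩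
    · rcases eq_or_ne i j with rfl | hij
      · simpa using hCA
      · simpa [hij] using hBA i (by omega)
    · rcases eq_or_ne i j with rfl | hij
      · simp only [Function.update_self]
        intro x hx y hy hxy
        obtain ⟨w, -, rfl⟩ := Finset.mem_image.mp hx
        obtain ⟨w', -, rfl⟩ := Finset.mem_image.mp hy
        exact hτ w w' fun h => hxy (by rw [h])
      · simpa [hij] using hom i (by omega)
    · exact (hdisj i (by omega) j (by omega) hi.ne).mono (hBA i hi) hCA
    · obtain ⟨f, h₁, h₂, h₃, h₄⟩ := H p Q fun x => τ '' {y | Q.Adj y x}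
      refine ⟨f, h₁, h₂, h₃, fun x y hx => ?_⟩
      rw [h₄ x (τ y) hx, τ.injective.mem_set_image]
      rfl

/-- **Lemma (`U(r,k)`-free or a forbidden graph).**  Let `r, m ∈ ℕ`.  There exists
`k₀ = k(r,m)` such that, whenever for each `v ∈ {0,1}^r` we are given a graph `H v` of
at most `m` vertices belonging to `ℋ(r,v)`, then for every `k ≥ k₀` and every graph `G`,
either `G` is `U(r,k)`-free or `G` contains an induced copy of `H v` for some `v`. -/
theorem Urk_free_or_forbidden (r m : ℕ) :
    ∃ k₀ : ℕ, ∀ (N : (Fin r → Bool) → ℕ) (H : ∀ v : Fin r → Bool, SimpleGraph (Fin (N v))),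
      (∀ v, N v ≤ m) → (∀ v, InHClass r v (H v)) →
      ∀ k : ℕ, k₀ ≤ k →
      ∀ (V : Type) [Fintype V] [DecidableEq V] (G : SimpleGraph V),
        (¬ ∃ A : Fin r → Finset V, IsUParts G r k A) ∨
        ∃ v : Fin r → Bool, ∃ f : Fin (N v) ↪ V,
          ∀ x y : Fin (N v), G.Adj (f x) (f y) ↔ (H v).Adj x y := by
  classical
  obtain ⟨k₀, hk₀⟩ := exists_homogeneous_universal r (Fin (m + 1))
  refine ⟨k₀, fun N H hN hH k hk V _ _ G => or_iff_not_imp_left.mpr fun hA => ?_⟩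
  obtain ⟨A, hdisj, hcard, hsh⟩ := not_not.mp hA
  rcases Nat.eq_zero_or_pos r with rfl | hr
  · obtain ⟨q, -⟩ := hH Fin.elim0
    exact ⟨Fin.elim0, ⟨fun x => (q x).elim0, fun x => (q x).elim0⟩, fun x => (q x).elim0⟩
  let A' : ℕ → Finset V := fun i => if h : i < r then A ⟨i, h⟩ else ∅
  have hA' (i : ℕ) (hi : i < r) : A' i = A ⟨i, hi⟩ := dif_pos hi
  obtain ⟨v, B, hBA, hom, hU⟩ := hk₀ V G A'
    (fun i hi i' hi' h => by
      rw [hA' i hi, hA' i' hi']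
      exact hdisj _ _ (by simpa using h))
    (by
      rw [hA' 0 hr, hcard]
      exact hk)
    (fun i hi h0 => by
      have hunion : (Finset.range i).biUnion A' =
          (Finset.univ.filter fun i' : Fin r => i' < ⟨i, hi⟩).biUnion A := by
        ext x
        simp only [Finset.mem_biUnion, Finset.mem_range, Finset.mem_filter, Finset.mem_univ,
          true_and]
        constructor
        · rintro ⟨a, ha, hx⟩
          rw [hA' a (ha.trans hi)] at hx
          exact ⟨⟨a, ha.trans hi⟩, ha, hx⟩
        · rintro ⟨a, ha, hx⟩
          exact ⟨a, ha, by rwa [hA' a a.2]⟩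
      rw [hA' i hi, hunion]
      exact hsh ⟨i, hi⟩ h0)
  let u : Fin r → Bool := fun i => v i
  obtain ⟨q, hq⟩ := hH u
  let e : Fin (N u) ↪ Fin (m + 1) := Fin.castLEEmb ((hN u).trans m.le_succ)
  let p : Fin (m + 1) → ℕ := fun x => if h : x.val < N u then q ⟨x, h⟩ else 0
  have hpe (x : Fin (N u)) : p (e x) = q x := dif_pos x.2
  have hp (x : Fin (m + 1)) : p x < r := by
    by_cases h : x.val < N u
    · simp only [p, dif_pos h, Fin.is_lt]
    · simpa only [p, dif_neg h] using hr
  obtain ⟨f, hfB, hadj⟩ := hU p hp ((H u).map e)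
  refine ⟨u, e.trans f, fun x y => ?_⟩
  simp only [Function.Embedding.trans_apply]
  by_cases hxy : x = y
  · simp [hxy]
  by_cases hpxy : q x = q y
  · rw [hq x y hxy hpxy]
    have hx := hfB (e x)
    have hy := hfB (e y)
    rw [hpe] at hx hy
    rw [← hpxy] at hy
    exact hom _ (q x).2 _ hx _ hy ((e.trans f).injective.ne hxy)
  · rw [hadj _ _ (by rw [hpe, hpe]; exact fun h => hpxy (Fin.ext h)),
      SimpleGraph.map_adj_apply]

end ABBM
end
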